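/- Let Ω ⊂ ℝ² be an open bounded Lipschitz domain and let e⁽¹⁾, e⁽²⁾, e⁽³⁾ be the hexagonal-to-rhombic wells. Then for any M ∈ ℝ^{2×2} with e(M) ∈ int conv({e⁽¹⁾, e⁽²⁾, e⁽³⁾}) there exists a Lipschitz map u : Ω → ℝ² solving the differential inclusion e(∇u) ∈ {e⁽¹⁾, e⁽²⁾, e⁽³⁾} a.e. in Ω with u(x) = Mx on ∂Ω. Moreover, for every ε > 0 there is such a solution u_ε additionally satisfying ‖u_ε − Mx‖_{L^∞(Ω)} < ε. -/

import Mathlib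

noncomputable section
open MeasureTheory Set
open scoped Matrix

abbrev Euc2 := EuclideanSpace ℝ (Fin 2)

/-- The hexagonal-to-rhombic wells `e⁽¹⁾, e⁽²⁾, e⁽³⁾`. -/
def hexWells : Fin 3 → Matrix (Fin 2) (Fin 2) ℝ :=
  ![!![1, 0; 0, -1],
    (1/2 : ℝ) • !![-1, Real.sqrt 3; Real.sqrt 3, 1],
    (1/2 : ℝ) • !![-1, -Real.sqrt 3; -Real.sqrt 3, 1]]

/-- The set of wells `K = {e⁽¹⁾, e⁽²⁾, e⁽³⁾}`. -/
def hexK : Set (Matrix (Fin 2) (Fin 2) ℝ) := {hexWells 0, hexWells 1, hexWells 2}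

/-- The symmetrised tensor product `a ⊙ n = (1/2)(a nᵀ + n aᵀ)`. -/
def odot (a nv : Euc2) : Matrix (Fin 2) (Fin 2) ℝ :=
  fun i j => (a i * nv j + nv i * a j) / 2

/-- The symmetric part `e(M) = (1/2)(M + Mᵀ)`. -/
def symPart (M : Matrix (Fin 2) (Fin 2) ℝ) : Matrix (Fin 2) (Fin 2) ℝ :=
  (1/2 : ℝ) • (M + Mᵀ)

/-- `A` lies in the interior of the convex hull of the wells, taken within the plane of
symmetric trace-free `2×2` matrices: all barycentric coordinates are positive. -/
def inIntConv (A : Matrix (Fin 2) (Fin 2) ℝ) : Prop :=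
  ∃ lam : Fin 3 → ℝ, (∀ i, 0 < lam i) ∧ (∑ i, lam i) = 1 ∧ A = ∑ i, lam i • hexWells i

def matVec2 (M : Matrix (Fin 2) (Fin 2) ℝ) (x : Euc2) : Euc2 :=
  WithLp.toLp 2 (fun i => ∑ j, M i j * x j)

def grad2 (w : Euc2 → Euc2) (x : Euc2) : Matrix (Fin 2) (Fin 2) ℝ :=
  fun i j => fderiv ℝ w x (EuclideanSpace.single j 1) i

def fro2 (A : Matrix (Fin 2) (Fin 2) ℝ) : ℝ := Real.sqrt (∑ i, ∑ j, (A i j)^2)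

def distK2 (A : Matrix (Fin 2) (Fin 2) ℝ) (K : Set (Matrix (Fin 2) (Fin 2) ℝ)) : ℝ :=
  sInf ((fun B => fro2 (A - B)) '' K)

/-- A bounded open set in the plane is a Lipschitz domain if near each boundary point,
in suitable rotated coordinates, it is the subgraph region of a Lipschitz function. -/
def IsLipschitzDomain (Ω : Set Euc2) : Prop :=
  ∀ x ∈ frontier Ω, ∃ (A : Euc2 ≃ₗᵢ[ℝ] Euc2) (r : ℝ) (φ : ℝ → ℝ) (L : NNReal),
    0 < r ∧ LipschitzWith L φ ∧
    ∀ y ∈ Metric.ball x r, (y ∈ Ω ↔ φ ((A (y - x)) 0) < (A (y - x)) 1)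

open scoped ContDiff

abbrev D2 := Euc2 →L[ℝ] Euc2

def ee (j : Fin 2) : Euc2 := EuclideanSpace.single j 1

/-- trace-free strain as a complex number -/
def Zl : D2 →ₗ[ℝ] ℂ where
  toFun A := ⟨(A (ee 0) 0 - A (ee 1) 1) / 2, (A (ee 1) 0 + A (ee 0) 1) / 2⟩
  map_add' A B := by
    apply Complex.ext <;> simp <;> ring
  map_smul' c A := by
    apply Complex.ext <;> simp <;> ring

/-- skew part -/
def skl : D2 →ₗ[ℝ] ℝ where
  toFun A := (A (ee 0) 1 - A (ee 1) 0) / 2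
  map_add' A B := by simp; ring
  map_smul' c A := by simp; ring

/-- trace -/
def trl : D2 →ₗ[ℝ] ℝ where
  toFun A := A (ee 0) 0 + A (ee 1) 1
  map_add' A B := by simp; ring
  map_smul' c A := by simp; ring

theorem Zl_cont : Continuous Zl := LinearMap.continuous_of_finiteDimensional _
theorem skl_cont : Continuous skl := LinearMap.continuous_of_finiteDimensional _
theorem trl_cont : Continuous trl := LinearMap.continuous_of_finiteDimensional _

def nu : Fin 3 → ℂ := ![⟨1, 0⟩, ⟨-1/2, Real.sqrt 3 / 2⟩, ⟨-1/2, -Real.sqrt 3 / 2⟩]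

def pr (i : Fin 3) (z : ℂ) : ℝ := z.re * (nu i).re + z.im * (nu i).im

theorem pr_cont (i : Fin 3) : Continuous (pr i) := by
  unfold pr; fun_prop

theorem pr_add (i : Fin 3) (z w : ℂ) : pr i (z + w) = pr i z + pr i w := by
  simp [pr]; ring

theorem pr_smul (i : Fin 3) (t : ℝ) (w : ℂ) : pr i (t • w) = t * pr i w := by
  simp [pr]; ring

theorem pr_sub (i : Fin 3) (z w : ℂ) : pr i (z - w) = pr i z - pr i w := by
  simp [pr]; ring

theorem sq3 : Real.sqrt 3 * Real.sqrt 3 = 3 := Real.mul_self_sqrt (by norm_num)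

theorem pr_nu (i k : Fin 3) : pr i (nu k) = if i = k then 1 else -1/2 := by
  have := sq3
  fin_cases i <;> fin_cases k <;> simp [pr, nu] <;> nlinarith

def UU (R : ℝ) : Set D2 :=
  {A | (∀ i, -1/2 < pr i (Zl A)) ∧ ∃ i, |skl A| + ‖Zl A - nu i‖ < R}

theorem isOpen_UU (R : ℝ) : IsOpen (UU R) := by
  have h1 : IsOpen {A : D2 | ∀ i, -1/2 < pr i (Zl A)} := by
    simp only [ofPred_forall]
    exact isOpen_iInter_of_finite fun i =>
      isOpen_lt continuous_const ((pr_cont i).comp Zl_cont)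
  have h2 : IsOpen {A : D2 | ∃ i, |skl A| + ‖Zl A - nu i‖ < R} := by
    simp only [ofPred_exists]
    refine isOpen_iUnion fun i => isOpen_lt ?_ continuous_const
    exact (skl_cont.abs).add (Zl_cont.sub continuous_const).norm
  exact h1.inter h2

theorem normSq_formula (z : ℂ) : 1 - ‖z‖ ^ 2 =
    ((1 + 2 * pr 0 z) * (1 + 2 * pr 1 z) + (1 + 2 * pr 0 z) * (1 + 2 * pr 2 z)
      + (1 + 2 * pr 1 z) * (1 + 2 * pr 2 z)) / 3 := by
  have := sq3
  rw [← Complex.normSq_eq_norm_sq, Complex.normSq_apply]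
  simp [pr, nu]
  linear_combination (z.im ^ 2 / 3) * this

theorem norm_le_one_of_tri {z : ℂ} (h : ∀ i, -1/2 ≤ pr i z) : ‖z‖ ≤ 1 := by
  have h0 := h 0; have h1 := h 1; have h2 := h 2
  have := normSq_formula z
  have : ‖z‖ ^ 2 ≤ 1 := by
    have := mul_nonneg (by linarith : (0:ℝ) ≤ 1 + 2 * pr 0 z) (by linarith : (0:ℝ) ≤ 1 + 2 * pr 1 z)
    have := mul_nonneg (by linarith : (0:ℝ) ≤ 1 + 2 * pr 0 z) (by linarith : (0:ℝ) ≤ 1 + 2 * pr 2 z)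
    have := mul_nonneg (by linarith : (0:ℝ) ≤ 1 + 2 * pr 1 z) (by linarith : (0:ℝ) ≤ 1 + 2 * pr 2 z)
    linarith
  nlinarith [norm_nonneg z]

theorem pr_sum (z : ℂ) : pr 0 z + pr 1 z + pr 2 z = 0 := by
  simp [pr, nu]; ring

theorem vertex_of_norm {z : ℂ} (h : ∀ i, -1/2 ≤ pr i z) (hz : 1 ≤ ‖z‖ ^ 2) :
    ∃ i, z = nu i := by
  have h0 := h 0; have h1 := h 1; have h2 := h 2
  have hf := normSq_formula z
  have hs := pr_sum z
  have a01 := mul_nonneg (by linarith : (0:ℝ) ≤ 1 + 2 * pr 0 z) (by linarith : (0:ℝ) ≤ 1 + 2 * pr 1 z)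
  have a02 := mul_nonneg (by linarith : (0:ℝ) ≤ 1 + 2 * pr 0 z) (by linarith : (0:ℝ) ≤ 1 + 2 * pr 2 z)
  have a12 := mul_nonneg (by linarith : (0:ℝ) ≤ 1 + 2 * pr 1 z) (by linarith : (0:ℝ) ≤ 1 + 2 * pr 2 z)
  have b01 : (1 + 2 * pr 0 z) * (1 + 2 * pr 1 z) = 0 := by linarith
  have b02 : (1 + 2 * pr 0 z) * (1 + 2 * pr 2 z) = 0 := by linarith
  have b12 : (1 + 2 * pr 1 z) * (1 + 2 * pr 2 z) = 0 := by linarith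
  have s3 : 0 < Real.sqrt 3 := by positivity
  have q := sq3
  have key : (pr 1 z = -1/2 ∧ pr 2 z = -1/2) ∨ (pr 0 z = -1/2 ∧ pr 2 z = -1/2) ∨
      (pr 0 z = -1/2 ∧ pr 1 z = -1/2) := by
    rcases mul_eq_zero.1 b01 with h | h <;> rcases mul_eq_zero.1 b12 with h' | h' <;>
    rcases mul_eq_zero.1 b02 with h'' | h''
    all_goals first
      | (exfalso; linarith)
      | exact Or.inl ⟨by linarith, by linarith⟩
      | exact Or.inr (Or.inl ⟨by linarith, by linarith⟩)
      | exact Or.inr (Or.inr ⟨by linarith, by linarith⟩)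
  simp only [pr, nu] at key
  simp at key
  rcases key with ⟨k1, k2⟩ | ⟨k1, k2⟩ | ⟨k1, k2⟩
  · refine ⟨0, Complex.ext ?_ ?_⟩ <;> simp [nu]
    · nlinarith
    · nlinarith
  · refine ⟨1, Complex.ext ?_ ?_⟩ <;> simp [nu]
    · nlinarith
    · nlinarith
  · refine ⟨2, Complex.ext ?_ ?_⟩ <;> simp [nu]
    · nlinarith
    · nlinarith

def Jv (v : Euc2) : Euc2 := !₂[-v 1, v 0]

/-- rank-one matrix `Jn ⊗ n` -/
def rk (n : Euc2) : D2 := (innerSL ℝ n).smulRight (Jv n)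

theorem inner_ee (n : Euc2) (j : Fin 2) : inner ℝ n (ee j) = n j := by
  simp [ee, EuclideanSpace.inner_single_right]

theorem rk_apply (n y : Euc2) : rk n y = (inner ℝ n y : ℝ) • Jv n := by
  simp [rk]

theorem exists_rk (c : ℂ) : ∃ n : Euc2, Zl (rk n) = c ∧ skl (rk n) = ‖c‖ ∧ trl (rk n) = 0 := by
  obtain ⟨w, hw⟩ := IsAlgClosed.exists_pow_nat_eq (-2 * Complex.I * c) (n := 2) (by norm_num)
  have hre := congrArg Complex.re hw
  have him := congrArg Complex.im hw
  have hn := congrArg norm hw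
  simp [pow_two] at hre him
  simp only [norm_pow, norm_mul, norm_neg, Complex.norm_I, mul_one] at hn
  rw [← Complex.normSq_eq_norm_sq, Complex.normSq_apply] at hn
  norm_num at hn
  refine ⟨!₂[w.re, w.im], Complex.ext ?_ ?_, ?_, ?_⟩
  · simp [Zl, rk_apply, inner_ee, Jv]; linarith
  · simp [Zl, rk_apply, inner_ee, Jv]; linarith
  · simp [skl, rk_apply, inner_ee, Jv]; linarith
  · simp [trl, rk_apply, inner_ee, Jv]; ring

theorem exists_max_pr (z : ℂ) : ∃ i, ∀ k, pr k z ≤ pr i z := by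
  obtain ⟨i, -, hi⟩ := Finset.exists_max_image (Finset.univ : Finset (Fin 3)) (fun k => pr k z)
    ⟨0, Finset.mem_univ _⟩
  exact ⟨i, fun k => hi k (Finset.mem_univ _)⟩

theorem norm_sub_nu_sq (z : ℂ) (i : Fin 3) : ‖z - nu i‖ ^ 2 = ‖z‖ ^ 2 + 1 - 2 * pr i z := by
  have := sq3
  simp only [← Complex.normSq_eq_norm_sq, Complex.normSq_apply]
  fin_cases i <;> simp [pr, nu] <;> nlinarith

theorem norm_nu (i : Fin 3) : ‖nu i‖ = 1 := by
  have h := norm_sub_nu_sq 0 i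
  simp [pr] at h
  rcases h with h | h
  · exact h
  · linarith [norm_nonneg (nu i)]

theorem UU_step {R : ℝ} (hR : 4 ≤ R) {A : D2} (hA : A ∈ UU R) :
    ∃ n : Euc2, (∀ t : ℝ, |t| ≤ 1 → A + t • rk n ∈ UU R) ∧ trl (rk n) = 0 ∧
      1 - ‖Zl A‖ ^ 2 ≤ 8 * ‖Zl (rk n)‖ := by
  obtain ⟨h1, k, hk⟩ := hA
  set z := Zl A with hz
  have hzn : ‖z‖ ≤ 1 := norm_le_one_of_tri fun i => (h1 i).le
  obtain ⟨i, hi⟩ := exists_max_pr z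
  have hi0 : 0 ≤ pr i z := by
    have := pr_sum z; have := hi 0; have := hi 1; have := hi 2; linarith
  set d := ‖z - nu i‖ with hd
  have hdk : d ≤ ‖z - nu k‖ := by
    have e1 := norm_sub_nu_sq z i
    have e2 := norm_sub_nu_sq z k
    have := hi k
    exact le_of_sq_le_sq (by rw [hd]; linarith) (norm_nonneg _)
  have hd0 : 0 ≤ d := norm_nonneg _
  have hd2 : d ≤ 2 := by
    have e1 := norm_sub_nu_sq z i
    rw [← hd] at e1
    nlinarith [norm_nonneg z]
  have hdR : |skl A| + d < R := by linarith
  -- sign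
  obtain ⟨σ, hσ, hσs⟩ : ∃ σ : ℝ, (σ = 1 ∨ σ = -1) ∧ skl A = σ * |skl A| := by
    rcases le_total 0 (skl A) with h | h
    · exact ⟨1, Or.inl rfl, by rw [abs_of_nonneg h]; ring⟩
    · exact ⟨-1, Or.inr rfl, by rw [abs_of_nonpos h]; ring⟩
  have hσ2 : σ * σ = 1 := by rcases hσ with h | h <;> rw [h] <;> norm_num
  have hσa : |σ| = 1 := by rcases hσ with h | h <;> rw [h] <;> norm_num
  obtain ⟨n, hn1, hn2, hn3⟩ := exists_rk ((σ / 4 : ℝ) • (nu i - z))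
  have hcn : ‖(σ / 4 : ℝ) • (nu i - z)‖ = d / 4 := by
    rw [norm_smul, norm_sub_rev, ← hd, Real.norm_eq_abs, abs_div, hσa]; norm_num; ring
  rw [hcn] at hn2
  refine ⟨n, ?_, hn3, ?_⟩
  · intro t ht
    obtain ⟨τ, hτ, hτt⟩ : ∃ τ : ℝ, |τ| ≤ 1 / 4 ∧ t = 4 * σ * τ := by
      refine ⟨σ * t / 4, ?_, ?_⟩
      · rw [abs_div, abs_mul, hσa]; norm_num; linarith
      · linear_combination (-t) * hσ2
    have hZ : Zl (A + t • rk n) = z + τ • (nu i - z) := by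
      rw [map_add, map_smul, hn1, smul_smul, hτt]
      congr 2; linear_combination τ * hσ2
    have hS : skl (A + t • rk n) = σ * (|skl A| + τ * d) := by
      rw [map_add, map_smul, hn2, hτt, smul_eq_mul]
      nth_rewrite 1 [hσs]; ring
    have ⟨hτ1, hτ2⟩ := abs_le.1 hτ
    refine ⟨fun k => ?_, i, ?_⟩
    · rw [hZ, pr_add, pr_smul, pr_sub, pr_nu]
      have hk1 := h1 k
      split_ifs with hki
      · subst hki; nlinarith
      · nlinarith
    · have e1 : ‖Zl (A + t • rk n) - nu i‖ = (1 - τ) * d := by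
        rw [hZ]
        have : z + τ • (nu i - z) - nu i = (1 - τ) • (z - nu i) := by
          simp only [smul_sub, sub_smul, one_smul]; ring
        rw [this, norm_smul, Real.norm_eq_abs, abs_of_nonneg (by linarith)]
      have e2 : |skl (A + t • rk n)| = |(|skl A| + τ * d)| := by
        rw [hS, abs_mul, hσa, one_mul]
      rw [e1, e2]
      have := abs_nonneg (skl A)
      rcases abs_cases (|skl A| + τ * d) with ⟨h, _⟩ | ⟨h, h'⟩ <;> rw [h]
      · linarith
      · nlinarith [mul_nonneg (by linarith : 0 ≤ τ + 1 / 4) hd0]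
  · rw [hn1, hcn]
    have : ‖nu i‖ ≤ ‖z‖ + ‖z - nu i‖ := by
      have := norm_sub_le z (z - nu i); simpa using this
    rw [norm_nu, ← hd] at this
    nlinarith [norm_nonneg z]

/-- norm bound on `UU` -/
theorem UU_norm_bound {R : ℝ} {A : D2} (hA : A ∈ UU R) (htr : trl A = 0) : ‖A‖ ≤ 4 * (R + 1) := by
  obtain ⟨h1, k, hk⟩ := hA
  have hzn : ‖Zl A‖ ≤ 1 := norm_le_one_of_tri fun i => (h1 i).le
  have hs : |skl A| ≤ R := by linarith [norm_nonneg (Zl A - nu k)]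
  have hre := (Complex.abs_re_le_norm (Zl A)).trans hzn
  have him := (Complex.abs_im_le_norm (Zl A)).trans hzn
  have hR : 0 ≤ R := (abs_nonneg _).trans hs
  simp only [trl, LinearMap.coe_mk, AddHom.coe_mk] at htr
  simp only [skl, LinearMap.coe_mk, AddHom.coe_mk] at hs
  simp only [Zl, LinearMap.coe_mk, AddHom.coe_mk] at hre him
  rw [abs_le] at hs hre him
  have en : ∀ v : Euc2, ‖v‖ ≤ |v 0| + |v 1| := by
    intro v
    rw [EuclideanSpace.norm_eq]
    simp only [Fin.sum_univ_two, Real.norm_eq_abs]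
    apply Real.sqrt_le_iff.2
    constructor
    · positivity
    · nlinarith [abs_nonneg (v 0), abs_nonneg (v 1)]
  have c0 : ‖A (ee 0)‖ ≤ 2 * (R + 1) := by
    refine (en _).trans ?_
    have : |A (ee 0) 0| ≤ 1 := abs_le.2 ⟨by linarith, by linarith⟩
    have : |A (ee 0) 1| ≤ R + 1 := abs_le.2 ⟨by linarith, by linarith⟩
    linarith
  have c1 : ‖A (ee 1)‖ ≤ 2 * (R + 1) := by
    refine (en _).trans ?_
    have : |A (ee 1) 1| ≤ 1 := abs_le.2 ⟨by linarith, by linarith⟩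
    have : |A (ee 1) 0| ≤ R + 1 := abs_le.2 ⟨by linarith, by linarith⟩
    linarith
  refine ContinuousLinearMap.opNorm_le_bound _ (by positivity) fun v => ?_
  have hv : v = v 0 • ee 0 + v 1 • ee 1 := by
    ext i; fin_cases i <;> simp [ee]
  have v0 : |v 0| ≤ ‖v‖ := PiLp.norm_apply_le v 0
  have v1 : |v 1| ≤ ‖v‖ := PiLp.norm_apply_le v 1
  calc ‖A v‖ = ‖v 0 • A (ee 0) + v 1 • A (ee 1)‖ := by
        conv_lhs => rw [hv]
        rw [map_add, map_smul, map_smul]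
    _ ≤ |v 0| * ‖A (ee 0)‖ + |v 1| * ‖A (ee 1)‖ := by
        refine (norm_add_le _ _).trans ?_
        rw [norm_smul, norm_smul]; rfl
    _ ≤ ‖v‖ * (2 * (R + 1)) + ‖v‖ * (2 * (R + 1)) := by gcongr
    _ = 4 * (R + 1) * ‖v‖ := by ring

theorem UU_Z_le {R : ℝ} {A : D2} (hA : A ∈ UU R) : ‖Zl A‖ ≤ 1 :=
  norm_le_one_of_tri fun i => (hA.1 i).le

theorem local_pert (n x0 : Euc2) {r δ ε : ℝ} (hr : 0 < r) (hδ : 0 < δ) (hε : 0 < ε) :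
    ∃ k : ℝ, ∀ θ : ℝ, ∃ φ : Euc2 → Euc2, ContDiff ℝ ∞ φ ∧
      (∀ x, x ∉ Metric.closedBall x0 r → φ x = 0) ∧ (∀ x, ‖φ x‖ < ε) ∧
      (∀ x, trl (fderiv ℝ φ x) = 0) ∧
      (∀ x, ∃ t : ℝ, |t| ≤ 1 ∧ ‖fderiv ℝ φ x - t • rk n‖ < δ) ∧
      (∀ x ∈ Metric.ball x0 (r / 2),
        fderiv ℝ φ x = Real.cos (k * inner ℝ n x + θ) • rk n) := by
  let η : ContDiffBump x0 := ⟨r / 2, r, by linarith, by linarith⟩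
  have hη : ContDiff ℝ ∞ (η : Euc2 → ℝ) := η.contDiff
  have hηc : HasCompactSupport (η : Euc2 → ℝ) := η.hasCompactSupport
  let Dη : Euc2 → (Euc2 →L[ℝ] ℝ) := fderiv ℝ (η : Euc2 → ℝ)
  have hDη : ContDiff ℝ ∞ Dη := hη.fderiv_right (by simp)
  have hDηc : HasCompactSupport Dη := hηc.fderiv ℝ
  let V : Euc2 → Euc2 := fun x => (Dη x (ee 0)) • ee 1 - (Dη x (ee 1)) • ee 0
  have hV : ContDiff ℝ ∞ V :=
    ((hDη.clm_apply contDiff_const).smul contDiff_const).sub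
      ((hDη.clm_apply contDiff_const).smul contDiff_const)
  have hVc : HasCompactSupport V := by
    refine hDηc.mono fun x hx => ?_
    contrapose! hx
    simp only [Function.mem_support, not_not] at hx
    simp [V, hx]
  have hDVc : HasCompactSupport (fderiv ℝ V) := hVc.fderiv ℝ
  obtain ⟨B1, hB1⟩ := hVc.exists_bound_of_continuous hV.continuous
  obtain ⟨B2, hB2⟩ := hDVc.exists_bound_of_continuous (hV.continuous_fderiv (by simp))
  obtain ⟨B3, hB3⟩ := hDηc.exists_bound_of_continuous hDη.continuous
  have hB10 : 0 ≤ B1 := (norm_nonneg _).trans (hB1 0)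
  have hB20 : 0 ≤ B2 := (norm_nonneg _).trans (hB2 0)
  have hB30 : 0 ≤ B3 := (norm_nonneg _).trans (hB3 0)
  set m := Jv n with hm
  let T : ℝ := B2 + ‖n‖ * B1 + B3 * ‖m‖ + B1 + ‖m‖ + 1
  have hT : 0 < T := by positivity
  let k : ℝ := 1 + T / min δ ε
  have hmin : 0 < min δ ε := lt_min hδ hε
  have hk1 : 1 ≤ k := by
    have : 0 < T / min δ ε := by positivity
    simp only [k]; linarith
  have hk0 : 0 < k := by linarith
  have hki1 : k⁻¹ ≤ 1 := inv_le_one_of_one_le₀ hk1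
  have hki0 : 0 < k⁻¹ := by positivity
  have hkT : k⁻¹ * T < min δ ε := by
    rw [inv_mul_lt_iff₀ hk0]
    simp only [k]
    rw [add_mul, div_mul_cancel₀ _ hmin.ne']; linarith
  have hηb : ∀ x, |η x| ≤ 1 := fun x => by
    rw [abs_of_nonneg η.nonneg]; exact η.le_one
  refine ⟨k, fun θ => ?_⟩
  let Cf : Euc2 → ℝ := fun x => Real.cos (k * inner ℝ n x + θ)
  let Sf : Euc2 → ℝ := fun x => Real.sin (k * inner ℝ n x + θ)
  have hCb : ∀ x, |Cf x| ≤ 1 := fun x => Real.abs_cos_le_one _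
  have hSb : ∀ x, |Sf x| ≤ 1 := fun x => Real.abs_sin_le_one _
  have hin : ContDiff ℝ ∞ (fun x : Euc2 => k * inner ℝ n x + θ) :=
    (contDiff_const.mul (innerSL ℝ n).contDiff).add contDiff_const
  have hC : ContDiff ℝ ∞ Cf := Real.contDiff_cos.comp hin
  have hS : ContDiff ℝ ∞ Sf := Real.contDiff_sin.comp hin
  have hind : ∀ x, HasFDerivAt (fun x : Euc2 => k * inner ℝ n x + θ) (k • innerSL ℝ n) x := by
    intro x
    have := ((innerSL ℝ n).hasFDerivAt (x := x)).const_mul k |>.add_const θ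
    exact this
  have hCd : ∀ x, HasFDerivAt Cf (-(Sf x) • (k • innerSL ℝ n)) x := fun x => (hind x).cos
  have hSd : ∀ x, HasFDerivAt Sf ((Cf x) • (k • innerSL ℝ n)) x := fun x => (hind x).sin
  let φ : Euc2 → Euc2 := fun x => (-(k⁻¹ * k⁻¹) * Cf x) • V x + (k⁻¹ * (Sf x * η x)) • m
  have hφ : ContDiff ℝ ∞ φ :=
    ((contDiff_const.mul hC).smul hV).add ((contDiff_const.mul (hS.mul hη)).smul contDiff_const)
  let Er : Euc2 → D2 := fun x => -(k⁻¹ * Cf x) • fderiv ℝ V x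
    + Sf x • (innerSL ℝ n).smulRight (V x) + Sf x • (Dη x).smulRight m
  have hφd : ∀ x, fderiv ℝ φ x = (η x * Cf x) • rk n + k⁻¹ • Er x := by
    intro x
    have hVd : HasFDerivAt V (fderiv ℝ V x) x := (hV.differentiable (by simp) x).hasFDerivAt
    have hηd : HasFDerivAt (η : Euc2 → ℝ) (Dη x) x :=
      (hη.differentiable (by simp) x).hasFDerivAt
    have h1 := ((hCd x).const_mul (-(k⁻¹ * k⁻¹))).smul hVd
    have h2 := (((hSd x).mul hηd).const_mul k⁻¹).smul_const m
    have h3 := (h1.add h2).fderiv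
    have h4 : fderiv ℝ φ x = _ := h3
    rw [h4]
    ext y i
    simp [Er, rk_apply, hm]
    field_simp
    ring
  have hErb : ∀ x, ‖Er x‖ ≤ B2 + ‖n‖ * B1 + B3 * ‖m‖ := by
    intro x
    refine (norm_add₃_le).trans ?_
    rw [norm_smul, norm_smul, norm_smul, ContinuousLinearMap.norm_smulRight_apply,
      ContinuousLinearMap.norm_smulRight_apply, innerSL_apply_norm, norm_neg, norm_mul]
    simp only [Real.norm_eq_abs, abs_of_pos hki0]
    have a1 := hCb x; have a2 := hSb x
    gcongr ?_ + ?_ + ?_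
    · calc k⁻¹ * |Cf x| * ‖fderiv ℝ V x‖ ≤ 1 * 1 * B2 := by gcongr; exact hB2 x
        _ = B2 := by ring
    · calc |Sf x| * (‖n‖ * ‖V x‖) ≤ 1 * (‖n‖ * B1) := by gcongr; exact hB1 x
        _ = _ := by ring
    · calc |Sf x| * (‖Dη x‖ * ‖m‖) ≤ 1 * (B3 * ‖m‖) := by gcongr; exact hB3 x
        _ = _ := by ring
  have hnear : ∀ x ∈ Metric.ball x0 (r / 2), Dη x = 0 ∧ V x = 0 ∧ fderiv ℝ V x = 0 ∧ η x = 1 := by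
    have hD : ∀ x ∈ Metric.ball x0 (r / 2), Dη x = 0 := by
      intro x hx
      have : (η : Euc2 → ℝ) =ᶠ[nhds x] fun _ => 1 := by
        filter_upwards [Metric.isOpen_ball.mem_nhds hx] with y hy
        exact η.one_of_mem_closedBall (Metric.ball_subset_closedBall hy)
      simp only [Dη]
      rw [this.fderiv_eq]; simp
    intro x hx
    refine ⟨hD x hx, by simp [V, hD x hx], ?_, ?_⟩
    · have : V =ᶠ[nhds x] fun _ => 0 := by
        filter_upwards [Metric.isOpen_ball.mem_nhds hx] with y hy
        simp [V, hD y hy]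
      rw [this.fderiv_eq]; simp
    · exact η.one_of_mem_closedBall (Metric.ball_subset_closedBall hx)
  refine ⟨φ, hφ, ?_, ?_, ?_, ?_, ?_⟩
  · intro x hx
    have e : (η : Euc2 → ℝ) =ᶠ[nhds x] fun _ => 0 := by
      filter_upwards [Metric.isClosed_closedBall.isOpen_compl.mem_nhds hx] with y hy
      apply η.zero_of_le_dist
      simp only [mem_compl_iff, Metric.mem_closedBall, not_le] at hy
      exact hy.le
    have e1 : Dη x = 0 := by
      simp only [Dη]
      rw [e.fderiv_eq]; simp
    have e2 := e.eq_of_nhds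
    simp [φ, V, e1, e2]
  · intro x
    have : ‖φ x‖ ≤ k⁻¹ * T := by
      calc ‖φ x‖ ≤ ‖(-(k⁻¹ * k⁻¹) * Cf x) • V x‖ + ‖(k⁻¹ * (Sf x * η x)) • m‖ := norm_add_le _ _
        _ = k⁻¹ * k⁻¹ * |Cf x| * ‖V x‖ + k⁻¹ * (|Sf x| * |η x|) * ‖m‖ := by
          rw [norm_smul, norm_smul]
          simp only [norm_mul, norm_neg, Real.norm_eq_abs, abs_of_pos hki0]
        _ ≤ k⁻¹ * 1 * 1 * B1 + k⁻¹ * (1 * 1) * ‖m‖ := by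
          gcongr
          · exact hCb x
          · exact hB1 x
          · exact hSb x
          · exact hηb x
        _ = k⁻¹ * (B1 + ‖m‖) := by ring
        _ ≤ k⁻¹ * T := by
          gcongr
          have : 0 ≤ B2 + ‖n‖ * B1 + B3 * ‖m‖ := by positivity
          simp only [T]; linarith
    exact this.trans_lt (hkT.trans_le (min_le_right _ _))
  · intro x
    have hsym : fderiv ℝ Dη x (ee 0) (ee 1) = fderiv ℝ Dη x (ee 1) (ee 0) := by
      have := (hη.contDiffAt (x := x)).isSymmSndFDerivAt
        (by simp; exact WithTop.coe_le_coe.2 le_top)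
      exact this _ _
    have hVx : ∀ y, fderiv ℝ V x y
        = (fderiv ℝ Dη x y (ee 0)) • ee 1 - (fderiv ℝ Dη x y (ee 1)) • ee 0 := by
      intro y
      have hd : HasFDerivAt Dη (fderiv ℝ Dη x) x :=
        (hDη.differentiable (by simp) x).hasFDerivAt
      have h0 := (hd.clm_apply (hasFDerivAt_const (ee 0) x)).smul_const (ee 1)
      have h1 := (hd.clm_apply (hasFDerivAt_const (ee 1) x)).smul_const (ee 0)
      have h2 : fderiv ℝ V x = _ := (h0.sub h1).fderiv
      rw [h2]; simp
    have t1 : trl (fderiv ℝ V x) = 0 := by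
      simp [trl, hVx, ee]
      simp [ee] at hsym
      linarith
    have t2 : trl (rk n) = 0 := by
      simp [trl, rk_apply, inner_ee, Jv]; ring
    have t3 : trl ((innerSL ℝ n).smulRight (V x)) + trl ((Dη x).smulRight m) = 0 := by
      have : ∀ j, (Dη x) (EuclideanSpace.single j 1) = Dη x (ee j) := fun _ => rfl
      simp [trl, V, hm, Jv, inner_ee]
      simp [ee]
      ring
    rw [hφd, map_add, map_smul, map_smul, t2]
    simp only [Er, map_add, map_smul, t1, zero_add, smul_eq_mul, ← mul_add, t3, mul_zero]
  · intro x
    refine ⟨η x * Cf x, ?_, ?_⟩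
    · rw [abs_mul]
      exact mul_le_one₀ (hηb x) (abs_nonneg _) (hCb x)
    · rw [hφd, add_sub_cancel_left, norm_smul, Real.norm_eq_abs, abs_of_pos hki0]
      refine lt_of_le_of_lt ?_ (hkT.trans_le (min_le_left _ _))
      gcongr
      refine (hErb x).trans ?_
      simp only [T]
      linarith [norm_nonneg m]
  · intro x hx
    obtain ⟨e1, e2, e3, e4⟩ := hnear x hx
    have : Er x = 0 := by
      ext y i
      simp [Er, e1, e2, e3]
    rw [hφd, this, e4]
    ext y i
    simp [Cf]

def cin (a b : ℂ) : ℝ := a.re * b.re + a.im * b.im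

theorem norm_add_sq_cin (a b : ℂ) : ‖a + b‖ ^ 2 - ‖a‖ ^ 2 = ‖b‖ ^ 2 + 2 * cin a b := by
  simp only [← Complex.normSq_eq_norm_sq, Complex.normSq_apply, cin, Complex.add_re, Complex.add_im]
  ring

theorem cin_neg (a b : ℂ) : cin a (-b) = - cin a b := by simp [cin]; ring

theorem abs_cin_le (a b : ℂ) : |cin a b| ≤ 2 * (‖a‖ * ‖b‖) := by
  unfold cin
  refine (abs_add_le _ _).trans ?_
  rw [abs_mul, abs_mul]
  have := mul_le_mul (Complex.abs_re_le_norm a) (Complex.abs_re_le_norm b) (abs_nonneg _) (norm_nonneg _)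
  have := mul_le_mul (Complex.abs_im_le_norm a) (Complex.abs_im_le_norm b) (abs_nonneg _) (norm_nonneg _)
  linarith

theorem fderiv_zero_outside {φ : Euc2 → Euc2} {S : Set Euc2} (hS : IsClosed S)
    (h : ∀ x, x ∉ S → φ x = 0) {x : Euc2} (hx : x ∉ S) : fderiv ℝ φ x = 0 := by
  have : φ =ᶠ[nhds x] fun _ => 0 := by
    filter_upwards [hS.isOpen_compl.mem_nhds hx] with y hy using h y hy
  rw [this.fderiv_eq]; simp

theorem vol_half (x : Euc2) {r : ℝ} (hr : 0 < r) :
    (volume (Metric.ball x (r / 2))).toReal = (volume (Metric.closedBall x r)).toReal / 4 := by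
  rw [Measure.addHaar_ball _ _ (by positivity), Measure.addHaar_closedBall _ _ hr.le,
    ENNReal.toReal_mul, ENNReal.toReal_mul, ENNReal.toReal_ofReal (by positivity),
    ENNReal.toReal_ofReal (by positivity)]
  simp
  ring

theorem integrableOn_of_cont_bdd {Ω : Set Euc2} (hΩf : volume Ω < ⊤)
    {f : Euc2 → ℝ} (hf : Continuous f) {C : ℝ} (hC : ∀ x, |f x| ≤ C) : IntegrableOn f Ω volume := by
  have : IsFiniteMeasure (volume.restrict Ω) := ⟨by simpa using hΩf⟩
  exact Integrable.of_bound hf.aestronglyMeasurable C (Filter.Eventually.of_forall hC)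

theorem ball_gain {Ω : Set Euc2} (hΩo : IsOpen Ω) (hΩf : volume Ω < ⊤) {R : ℝ} (hR : 4 ≤ R)
    {u : Euc2 → Euc2} (hu : ContDiff ℝ ∞ u) (hU : ∀ x, fderiv ℝ u x ∈ UU R) {x0 : Euc2}
    (hx0 : x0 ∈ Ω) :
    ∃ r : ℝ, 0 < r ∧ r ≤ 1 ∧ Metric.closedBall x0 r ⊆ Ω ∧ ∀ ε : ℝ, 0 < ε →
      ∃ φ : Euc2 → Euc2, ContDiff ℝ ∞ φ ∧ (∀ x, x ∉ Metric.closedBall x0 r → φ x = 0) ∧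
        (∀ x, ‖φ x‖ < ε) ∧ (∀ x, trl (fderiv ℝ φ x) = 0) ∧
        (∀ x, fderiv ℝ u x + fderiv ℝ φ x ∈ UU R) ∧
        (1 - ‖Zl (fderiv ℝ u x0)‖ ^ 2) ^ 2 / 512 * (volume (Metric.closedBall x0 r)).toReal ≤
          ∫ x in Ω, (‖Zl (fderiv ℝ u x + fderiv ℝ φ x)‖ ^ 2 - ‖Zl (fderiv ℝ u x)‖ ^ 2) := by
  obtain ⟨n, hn1, hn2, hn3⟩ := UU_step hR (hU x0)
  set A := fderiv ℝ u x0 with hA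
  have hDu : Continuous (fderiv ℝ u) := hu.continuous_fderiv (by simp)
  -- compact segment
  let S : Set D2 := (fun t : ℝ => A + t • rk n) '' Icc (-1) 1
  have hS : IsCompact S := isCompact_Icc.image (by fun_prop)
  have hSU : S ⊆ UU R := by
    rintro _ ⟨t, ht, rfl⟩
    exact hn1 t (abs_le.2 ht)
  obtain ⟨δ, hδ, hδU⟩ := hS.exists_thickening_subset_open (isOpen_UU R) hSU
  -- radius
  obtain ⟨r1, hr1, hr1U⟩ := Metric.continuous_iff.1 hDu x0 (δ / 2) (by positivity)
  obtain ⟨r2, hr2, hr2U⟩ := Metric.isOpen_iff.1 hΩo x0 hx0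
  let r := min (min (r1 / 2) (r2 / 2)) 1
  have hr : 0 < r := by simp only [r]; positivity
  have hrr1 : r < r1 := by
    have : r ≤ r1 / 2 := (min_le_left _ _).trans (min_le_left _ _)
    linarith
  have hrr2 : r < r2 := by
    have : r ≤ r2 / 2 := (min_le_left _ _).trans (min_le_right _ _)
    linarith
  have hrΩ : Metric.closedBall x0 r ⊆ Ω := (Metric.closedBall_subset_ball hrr2).trans hr2U
  refine ⟨r, hr, min_le_right _ _, hrΩ, fun ε hε => ?_⟩
  obtain ⟨k, hk⟩ := local_pert n x0 hr (half_pos hδ) hε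
  -- admissibility
  have adm : ∀ φ : Euc2 → Euc2, (∀ x, x ∉ Metric.closedBall x0 r → φ x = 0) →
      (∀ x, ∃ t : ℝ, |t| ≤ 1 ∧ ‖fderiv ℝ φ x - t • rk n‖ < δ / 2) →
      ∀ x, fderiv ℝ u x + fderiv ℝ φ x ∈ UU R := by
    intro φ h0 h1 x
    by_cases hx : x ∈ Metric.closedBall x0 r
    · obtain ⟨t, ht, ht'⟩ := h1 x
      apply hδU
      rw [Metric.mem_thickening_iff]
      refine ⟨A + t • rk n, ⟨t, abs_le.1 ht, rfl⟩, ?_⟩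
      have hd := hr1U x (lt_of_le_of_lt hx hrr1)
      rw [dist_eq_norm] at hd ⊢
      calc ‖fderiv ℝ u x + fderiv ℝ φ x - (A + t • rk n)‖
          = ‖(fderiv ℝ u x - A) + (fderiv ℝ φ x - t • rk n)‖ := by congr 1; abel
        _ ≤ _ := norm_add_le _ _
        _ < δ / 2 + δ / 2 := add_lt_add hd ht'
        _ = δ := by ring
    · rw [fderiv_zero_outside Metric.isClosed_closedBall h0 hx, add_zero]; exact hU x
  obtain ⟨φ0, a1, a2, a3, a4, a5, a6⟩ := hk 0
  obtain ⟨φ1, b1, b2, b3, b4, b5, b6⟩ := hk (-(Real.pi / 2))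
  set g := ‖Zl (rk n)‖ ^ 2 * (volume (Metric.ball x0 (r / 2))).toReal with hg
  have hZb : ∀ φ : Euc2 → Euc2, (∀ x, fderiv ℝ u x + fderiv ℝ φ x ∈ UU R) →
      ∀ x, ‖Zl (fderiv ℝ φ x)‖ ≤ 2 := by
    intro φ h x
    have e : Zl (fderiv ℝ φ x) = Zl (fderiv ℝ u x + fderiv ℝ φ x) - Zl (fderiv ℝ u x) := by
      rw [map_add]; ring
    rw [e]
    refine (norm_sub_le _ _).trans ?_
    have := UU_Z_le (h x); have := UU_Z_le (hU x); linarith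
  have hig : ∀ φ : Euc2 → Euc2, ContDiff ℝ ∞ φ → (∀ x, fderiv ℝ u x + fderiv ℝ φ x ∈ UU R) →
      IntegrableOn (fun x => ‖Zl (fderiv ℝ φ x)‖ ^ 2) Ω volume := by
    intro φ hφ h
    refine integrableOn_of_cont_bdd hΩf
      ((Zl_cont.comp (hφ.continuous_fderiv (by simp))).norm.pow 2) (C := 4) fun x => ?_
    have := hZb φ h x
    rw [abs_of_nonneg (by positivity)]
    nlinarith [norm_nonneg (Zl (fderiv ℝ φ x))]
  have hig2 : ∀ φ : Euc2 → Euc2, ContDiff ℝ ∞ φ → (∀ x, fderiv ℝ u x + fderiv ℝ φ x ∈ UU R) →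
      IntegrableOn (fun x => cin (Zl (fderiv ℝ u x)) (Zl (fderiv ℝ φ x))) Ω volume := by
    intro φ hφ h
    have c1 := Zl_cont.comp (hφ.continuous_fderiv (by simp))
    have c2 := Zl_cont.comp hDu
    refine integrableOn_of_cont_bdd hΩf ?_ (C := 4) fun x => ?_
    · unfold cin
      exact ((Complex.continuous_re.comp c2).mul (Complex.continuous_re.comp c1)).add
        ((Complex.continuous_im.comp c2).mul (Complex.continuous_im.comp c1))
    · have h1 := hZb φ h x
      have h2 := UU_Z_le (hU x)
      refine (abs_cin_le _ _).trans ?_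
      nlinarith [norm_nonneg (Zl (fderiv ℝ φ x)), norm_nonneg (Zl (fderiv ℝ u x))]
  have i0 := hig φ0 a1 (adm φ0 a2 a5)
  have i1 := hig φ1 b1 (adm φ1 b2 b5)
  have hsum : g ≤ (∫ x in Ω, ‖Zl (fderiv ℝ φ0 x)‖ ^ 2) + ∫ x in Ω, ‖Zl (fderiv ℝ φ1 x)‖ ^ 2 := by
    rw [← integral_add i0 i1]
    have hsub : Metric.ball x0 (r / 2) ⊆ Ω :=
      (Metric.ball_subset_closedBall.trans (Metric.closedBall_subset_closedBall (by linarith))).trans hrΩ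
    calc g = ∫ x in Metric.ball x0 (r / 2), ‖Zl (rk n)‖ ^ 2 := by
          rw [setIntegral_const, hg, smul_eq_mul, mul_comm]; rfl
      _ = ∫ x in Metric.ball x0 (r / 2),
            (‖Zl (fderiv ℝ φ0 x)‖ ^ 2 + ‖Zl (fderiv ℝ φ1 x)‖ ^ 2) := by
          refine setIntegral_congr_fun Metric.isOpen_ball.measurableSet fun x hx => ?_
          simp only [a6 x hx, b6 x hx, map_smul, norm_smul, mul_pow, Real.norm_eq_abs, sq_abs,
            add_zero]
          rw [← sub_eq_add_neg, Real.cos_sub_pi_div_two]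
          have := Real.sin_sq_add_cos_sq (k * inner ℝ n x)
          linear_combination (-‖Zl (rk n)‖ ^ 2) * this
      _ ≤ _ := by
          refine setIntegral_mono_set (i0.add i1) ?_ hsub.eventuallyLE
          exact Filter.Eventually.of_forall fun x => by simp only [Pi.zero_apply]; positivity
  have hfin : (1 - ‖Zl A‖ ^ 2) ^ 2 / 512 * (volume (Metric.closedBall x0 r)).toReal ≤ g / 2 := by
    have hv := vol_half x0 hr
    have h0 : 0 ≤ 1 - ‖Zl A‖ ^ 2 := by
      have := UU_Z_le (hU x0)
      rw [← hA] at this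
      nlinarith [norm_nonneg (Zl A)]
    have hsq : (1 - ‖Zl A‖ ^ 2) ^ 2 ≤ 64 * ‖Zl (rk n)‖ ^ 2 := by nlinarith
    rw [hg, hv]
    have : 0 ≤ (volume (Metric.closedBall x0 r)).toReal := ENNReal.toReal_nonneg
    nlinarith
  -- choose phase, then sign
  have key : ∀ φ : Euc2 → Euc2, ContDiff ℝ ∞ φ → (∀ x, x ∉ Metric.closedBall x0 r → φ x = 0) →
      (∀ x, ‖φ x‖ < ε) → (∀ x, trl (fderiv ℝ φ x) = 0) →
      (∀ x, ∃ t : ℝ, |t| ≤ 1 ∧ ‖fderiv ℝ φ x - t • rk n‖ < δ / 2) →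
      g / 2 ≤ (∫ x in Ω, ‖Zl (fderiv ℝ φ x)‖ ^ 2) →
      ∃ φ : Euc2 → Euc2, ContDiff ℝ ∞ φ ∧ (∀ x, x ∉ Metric.closedBall x0 r → φ x = 0) ∧
        (∀ x, ‖φ x‖ < ε) ∧ (∀ x, trl (fderiv ℝ φ x) = 0) ∧
        (∀ x, fderiv ℝ u x + fderiv ℝ φ x ∈ UU R) ∧ g / 2 ≤
          ∫ x in Ω, (‖Zl (fderiv ℝ u x + fderiv ℝ φ x)‖ ^ 2 - ‖Zl (fderiv ℝ u x)‖ ^ 2) := by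
    intro φ h1 h2 h3 h4 h5 h6
    have fn : ∀ x, fderiv ℝ (fun y => - φ y) x = - fderiv ℝ φ x := fun x => fderiv_fun_neg
    have hadm := adm φ h2 h5
    have j1 := hig φ h1 hadm
    have j2 := (hig2 φ h1 hadm).const_mul 2
    rcases le_total 0 (∫ x in Ω, 2 * cin (Zl (fderiv ℝ u x)) (Zl (fderiv ℝ φ x))) with hs | hs
    · refine ⟨φ, h1, h2, h3, h4, hadm, ?_⟩
      simp only [map_add, norm_add_sq_cin]
      rw [integral_add j1 j2]
      linarith
    · refine ⟨fun y => - φ y, h1.neg, fun x hx => by simp [h2 x hx], fun x => by simpa using h3 x,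
        fun x => by rw [fn, map_neg, h4, neg_zero], ?_, ?_⟩
      · apply adm
        · intro x hx; simp [h2 x hx]
        · intro x
          obtain ⟨t, ht, ht'⟩ := h5 x
          refine ⟨-t, by simpa using ht, ?_⟩
          have e : -fderiv ℝ φ x - (-t) • rk n = -(fderiv ℝ φ x - t • rk n) := by
            ext y i
            simp
            ring
          rw [fn, e, norm_neg]
          exact ht'
      · simp only [map_add, norm_add_sq_cin, fn, map_neg, cin_neg, norm_neg, mul_neg]
        simp only [← sub_eq_add_neg]
        rw [integral_sub j1 j2]
        linarith
  have : ∃ φ : Euc2 → Euc2, ContDiff ℝ ∞ φ ∧ (∀ x, x ∉ Metric.closedBall x0 r → φ x = 0) ∧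
        (∀ x, ‖φ x‖ < ε) ∧ (∀ x, trl (fderiv ℝ φ x) = 0) ∧
        (∀ x, fderiv ℝ u x + fderiv ℝ φ x ∈ UU R) ∧ g / 2 ≤
          ∫ x in Ω, (‖Zl (fderiv ℝ u x + fderiv ℝ φ x)‖ ^ 2 - ‖Zl (fderiv ℝ u x)‖ ^ 2) := by
    rcases le_total (g / 2) (∫ x in Ω, ‖Zl (fderiv ℝ φ0 x)‖ ^ 2) with h | h
    · exact key φ0 a1 a2 a3 a4 a5 h
    · exact key φ1 b1 b2 b3 b4 b5 (by linarith)
  obtain ⟨φ, h1, h2, h3, h4, h5, h6⟩ := this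
  exact ⟨φ, h1, h2, h3, h4, h5, hfin.trans h6⟩

structure Adm (Ω : Set Euc2) (M : Matrix (Fin 2) (Fin 2) ℝ) (R : ℝ) (u : Euc2 → Euc2) : Prop where
  smooth : ContDiff ℝ ∞ u
  bdry : ∃ C : Set Euc2, IsCompact C ∧ C ⊆ Ω ∧ ∀ x, x ∉ C → u x = matVec2 M x
  tr : ∀ x, trl (fderiv ℝ u x) = 0
  mem : ∀ x, fderiv ℝ u x ∈ UU R

def En (Ω : Set Euc2) (u : Euc2 → Euc2) : ℝ := ∫ x in Ω, ‖Zl (fderiv ℝ u x)‖ ^ 2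

theorem intEn {Ω : Set Euc2} (hΩf : volume Ω < ⊤) {R : ℝ} {u : Euc2 → Euc2}
    (hu : ContDiff ℝ ∞ u) (hU : ∀ x, fderiv ℝ u x ∈ UU R) :
    IntegrableOn (fun x => ‖Zl (fderiv ℝ u x)‖ ^ 2) Ω volume := by
  refine integrableOn_of_cont_bdd hΩf
      ((Zl_cont.comp (hu.continuous_fderiv (by simp))).norm.pow 2) (C := 1) fun x => ?_
  have := UU_Z_le (hU x)
  rw [abs_of_nonneg (by positivity)]
  nlinarith [norm_nonneg (Zl (fderiv ℝ u x))]

theorem step_gain : ∃ κ : ℝ, 0 < κ ∧ ∀ (Ω : Set Euc2), IsOpen Ω → volume Ω < ⊤ →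
    ∀ (M : Matrix (Fin 2) (Fin 2) ℝ) (R : ℝ), 4 ≤ R → ∀ u, Adm Ω M R u → ∀ l ε : ℝ, 0 < l → 0 < ε →
    ∃ v, Adm Ω M R v ∧ (∀ x, ‖v x - u x‖ < ε) ∧
      En Ω u + κ * l ^ 2 * (volume {x | x ∈ Ω ∧ l ≤ 1 - ‖Zl (fderiv ℝ u x)‖ ^ 2}).toReal ≤ En Ω v := by
  obtain ⟨N, τ, hτ, hN⟩ := HasBesicovitchCovering.no_satelliteConfig (α := Euc2)
  refine ⟨1 / (512 * (N + 1)), by positivity, ?_⟩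
  intro Ω hΩo hΩf M R hR u hu l ε hl hε
  set s : Set Euc2 := {x | x ∈ Ω ∧ l ≤ 1 - ‖Zl (fderiv ℝ u x)‖ ^ 2} with hs
  have H := fun (x : Euc2) (hx : x ∈ s) => ball_gain hΩo hΩf hR hu.smooth hu.mem hx.1
  choose! r hr0 hr1 hrΩ hr using H
  have H2 := fun (x : Euc2) (hx : x ∈ s) => hr x hx ε hε
  choose! φ p1 p2 p3 p4 p5 p6 using H2
  have : IsFiniteMeasure (volume.restrict Ω) := ⟨by simpa using hΩf⟩
  obtain ⟨t, hts, htm, htd⟩ := Besicovitch.exist_finset_disjoint_balls_large_measure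
    (volume.restrict Ω) hτ hN s r hr0 hr1
  have hts' : ∀ x ∈ t, x ∈ s := fun x hx => hts hx
  -- measure estimate
  have hmeas : (volume s).toReal ≤ (N + 1) * ∑ x ∈ t, (volume (Metric.closedBall x (r x))).toReal := by
    have hsΩ : s ⊆ Ω := fun x hx => hx.1
    have hsv : (volume.restrict Ω) s = volume s := Measure.restrict_eq_self _ hsΩ
    have h1 : volume s ≤ N / (N + 1) * volume s + ∑ x ∈ t, volume (Metric.closedBall x (r x)) := by
      calc volume s = (volume.restrict Ω) s := hsv.symm
        _ ≤ (volume.restrict Ω) ((s \ ⋃ x ∈ t, Metric.closedBall x (r x)) ∪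
              ⋃ x ∈ t, Metric.closedBall x (r x)) := measure_mono (by simp)
        _ ≤ _ := measure_union_le _ _
        _ ≤ N / (N + 1) * volume s + ∑ x ∈ t, volume (Metric.closedBall x (r x)) := by
            gcongr
            · rw [← hsv]; exact htm
            · refine (Measure.restrict_apply_le _ _).trans ?_
              exact measure_biUnion_finset_le _ _
    have hsf : volume s ≠ ⊤ := ((measure_mono hsΩ).trans_lt hΩf).ne
    have hBf : ∀ x ∈ t, volume (Metric.closedBall x (r x)) ≠ ⊤ := fun x _ =>
      measure_closedBall_lt_top.ne
    have hq : (N / (N + 1) : ENNReal) ≠ ⊤ := by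
      apply ENNReal.div_ne_top (by simp) (by simp)
    have h2 := ENNReal.toReal_mono (ENNReal.add_ne_top.2 ⟨ENNReal.mul_ne_top hq hsf,
      (ENNReal.sum_lt_top.2 fun x hx => (hBf x hx).lt_top).ne⟩) h1
    rw [ENNReal.toReal_add (ENNReal.mul_ne_top hq hsf)
      (ENNReal.sum_lt_top.2 fun x hx => (hBf x hx).lt_top).ne, ENNReal.toReal_mul,
      ENNReal.toReal_sum hBf, ENNReal.toReal_div] at h2
    have h3 : ((N : ENNReal) + 1).toReal = N + 1 := by
      rw [ENNReal.toReal_add (by simp) (by simp)]; simp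
    rw [h3, ENNReal.toReal_natCast] at h2
    have h4 : (N : ℝ) / (N + 1) = 1 - 1 / (N + 1) := by field_simp; ring
    rw [h4] at h2
    have h5 : 1 / ((N : ℝ) + 1) * (volume s).toReal ≤
        ∑ x ∈ t, (volume (Metric.closedBall x (r x))).toReal := by linarith
    rw [one_div, inv_mul_le_iff₀ (by positivity)] at h5
    exact h5
  -- pointwise dichotomy
  have dich : ∀ y : Euc2, (∃ x ∈ t, y ∈ Metric.closedBall x (r x) ∧
      ∀ x' ∈ t, x' ≠ x → y ∉ Metric.closedBall x' (r x')) ∨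
      ∀ x ∈ t, y ∉ Metric.closedBall x (r x) := by
    intro y
    by_cases h : ∃ x ∈ t, y ∈ Metric.closedBall x (r x)
    · obtain ⟨x, hx, hy⟩ := h
      left
      refine ⟨x, hx, hy, fun x' hx' hne hy' => ?_⟩
      exact Set.disjoint_left.1 (htd hx' hx hne) hy' hy
    · right
      push Not at h
      exact h
  have z1 : ∀ x ∈ t, ∀ y, y ∉ Metric.closedBall x (r x) → φ x y = 0 := fun x hx y hy =>
    p2 x (hts' x hx) y hy
  have z2 : ∀ x ∈ t, ∀ y, y ∉ Metric.closedBall x (r x) → fderiv ℝ (φ x) y = 0 := fun x hx y hy =>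
    fderiv_zero_outside Metric.isClosed_closedBall (z1 x hx) hy
  let v : Euc2 → Euc2 := fun y => u y + ∑ x ∈ t, φ x y
  have hvd : ∀ y, fderiv ℝ v y = fderiv ℝ u y + ∑ x ∈ t, fderiv ℝ (φ x) y := by
    intro y
    have a := (hu.smooth.differentiable (by simp) y).hasFDerivAt
    have b : ∀ x ∈ t, HasFDerivAt (φ x) (fderiv ℝ (φ x) y) y := fun x hx =>
      ((p1 x (hts' x hx)).differentiable (by simp) y).hasFDerivAt
    exact (a.add (HasFDerivAt.fun_sum b)).fderiv
  have hvs : ContDiff ℝ ∞ v :=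
    hu.smooth.add (ContDiff.sum fun x hx => p1 x (hts' x hx))
  have hvU : ∀ y, fderiv ℝ v y ∈ UU R := by
    intro y
    rw [hvd]
    rcases dich y with ⟨x, hx, hy, ho⟩ | h
    · rw [Finset.sum_eq_single_of_mem x hx fun x' hx' hne => z2 x' hx' y (ho x' hx' hne)]
      exact p5 x (hts' x hx) y
    · rw [Finset.sum_eq_zero fun x hx => z2 x hx y (h x hx), add_zero]
      exact hu.mem y
  refine ⟨v, ⟨hvs, ?_, ?_, hvU⟩, ?_, ?_⟩
  · obtain ⟨C, hC, hCΩ, hCu⟩ := hu.bdry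
    refine ⟨C ∪ ⋃ x ∈ t, Metric.closedBall x (r x), ?_, ?_, ?_⟩
    · exact hC.union (t.isCompact_biUnion fun x _ => isCompact_closedBall _ _)
    · refine union_subset hCΩ (iUnion₂_subset fun x hx => hrΩ x (hts' x hx))
    · intro y hy
      simp only [mem_union, mem_iUnion, not_or, not_exists] at hy
      simp only [v]
      rw [Finset.sum_eq_zero fun x hx => z1 x hx y (hy.2 x hx), add_zero]
      exact hCu y hy.1
  · intro y
    rw [hvd, map_add, map_sum, hu.tr, Finset.sum_eq_zero fun x hx => p4 x (hts' x hx) y, add_zero]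
  · intro y
    simp only [v, add_sub_cancel_left]
    rcases dich y with ⟨x, hx, hy, ho⟩ | h
    · rw [Finset.sum_eq_single_of_mem x hx fun x' hx' hne => z1 x' hx' y (ho x' hx' hne)]
      exact p3 x (hts' x hx) y
    · rw [Finset.sum_eq_zero fun x hx => z1 x hx y (h x hx), norm_zero]
      exact hε
  · have hIu := intEn hΩf hu.smooth hu.mem
    have hIv := intEn hΩf hvs hvU
    have hsm : ∀ x ∈ t, ContDiff ℝ ∞ (fun y => u y + φ x y) := fun x hx =>
      hu.smooth.add (p1 x (hts' x hx))
    have hfd : ∀ x ∈ t, ∀ y, fderiv ℝ (fun y => u y + φ x y) y = fderiv ℝ u y + fderiv ℝ (φ x) y :=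
      fun x hx y => fderiv_fun_add (hu.smooth.differentiable (by simp) y)
        ((p1 x (hts' x hx)).differentiable (by simp) y)
    have hIx : ∀ x ∈ t, IntegrableOn (fun y => ‖Zl (fderiv ℝ u y + fderiv ℝ (φ x) y)‖ ^ 2 -
        ‖Zl (fderiv ℝ u y)‖ ^ 2) Ω volume := by
      intro x hx
      have := intEn hΩf (R := R) (hsm x hx) (fun y => by
        rw [hfd x hx]; exact p5 x (hts' x hx) y)
      simp only [hfd x hx] at this
      exact this.sub hIu
    have hdiff : En Ω v - En Ω u = ∑ x ∈ t, ∫ y in Ω,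
        (‖Zl (fderiv ℝ u y + fderiv ℝ (φ x) y)‖ ^ 2 - ‖Zl (fderiv ℝ u y)‖ ^ 2) := by
      unfold En
      rw [← integral_sub hIv hIu, ← integral_finsetSum _ hIx]
      congr 1
      ext y
      rw [hvd]
      rcases dich y with ⟨x, hx, hy, ho⟩ | h
      · rw [Finset.sum_eq_single_of_mem x hx fun x' hx' hne => z2 x' hx' y (ho x' hx' hne)]
        rw [Finset.sum_eq_single_of_mem x hx fun x' hx' hne => by
          rw [z2 x' hx' y (ho x' hx' hne), add_zero, sub_self]]
      · rw [Finset.sum_eq_zero fun x hx => z2 x hx y (h x hx), add_zero, sub_self]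
        rw [Finset.sum_eq_zero fun x hx => by rw [z2 x hx y (h x hx), add_zero, sub_self]]
    have hge : ∑ x ∈ t, l ^ 2 / 512 * (volume (Metric.closedBall x (r x))).toReal ≤
        En Ω v - En Ω u := by
      rw [hdiff]
      refine Finset.sum_le_sum fun x hx => le_trans ?_ (p6 x (hts' x hx))
      have := (hts' x hx).2
      gcongr
    rw [← Finset.mul_sum] at hge
    have : 1 / (512 * ((N : ℝ) + 1)) * l ^ 2 * (volume s).toReal ≤
        l ^ 2 / 512 * ∑ x ∈ t, (volume (Metric.closedBall x (r x))).toReal := by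
      calc 1 / (512 * ((N : ℝ) + 1)) * l ^ 2 * (volume s).toReal
          ≤ 1 / (512 * ((N : ℝ) + 1)) * l ^ 2 *
            ((N + 1) * ∑ x ∈ t, (volume (Metric.closedBall x (r x))).toReal) := by gcongr
        _ = _ := by field_simp
    linarith

theorem En_le {Ω : Set Euc2} (hΩf : volume Ω < ⊤) {R : ℝ} {u : Euc2 → Euc2}
    (hu : ContDiff ℝ ∞ u) (hU : ∀ x, fderiv ℝ u x ∈ UU R) : En Ω u ≤ (volume Ω).toReal := by
  have h := setIntegral_mono (intEn hΩf hu hU) (integrableOn_const hΩf.ne (C := (1:ℝ))) (fun x => by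
    have := UU_Z_le (hU x)
    show _ ≤ (1:ℝ)
    nlinarith [norm_nonneg (Zl (fderiv ℝ u x))])
  simpa [En, measureReal_def] using h

theorem En_nonneg (Ω : Set Euc2) (u : Euc2 → Euc2) : 0 ≤ En Ω u :=
  integral_nonneg fun x => by simp only [Pi.zero_apply]; positivity

theorem level_lower {Ω : Set Euc2} (hΩo : IsOpen Ω) (hΩf : volume Ω < ⊤) {R : ℝ} {u : Euc2 → Euc2}
    (hu : ContDiff ℝ ∞ u) (hU : ∀ x, fderiv ℝ u x ∈ UU R) {l : ℝ} (hl : 0 < l) :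
    (volume Ω).toReal - En Ω u - l * (volume Ω).toReal ≤
      (volume {x | x ∈ Ω ∧ l ≤ 1 - ‖Zl (fderiv ℝ u x)‖ ^ 2}).toReal := by
  have hIu := intEn hΩf hu hU
  set T : Set Euc2 := {x | l ≤ 1 - ‖Zl (fderiv ℝ u x)‖ ^ 2} with hT
  have hTm : MeasurableSet T := by
    apply IsClosed.measurableSet
    exact isClosed_le continuous_const
      (continuous_const.sub ((Zl_cont.comp (hu.continuous_fderiv (by simp))).norm.pow 2))
  have e : {x | x ∈ Ω ∧ l ≤ 1 - ‖Zl (fderiv ℝ u x)‖ ^ 2} = T ∩ Ω := by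
    ext x; simp [hT, and_comm]
  rw [e]
  have i1 : IntegrableOn (fun _ : Euc2 => (1:ℝ)) Ω volume := integrableOn_const hΩf.ne
  have i2 : IntegrableOn (fun _ : Euc2 => l) Ω volume := integrableOn_const hΩf.ne
  have i3 : IntegrableOn (T.indicator fun _ : Euc2 => (1:ℝ)) Ω volume := i1.indicator hTm
  have h := setIntegral_mono (s := Ω) (hf := i1.sub hIu) (hg := i3.add i2) (fun x => by
    show (1:ℝ) - ‖Zl (fderiv ℝ u x)‖ ^ 2 ≤ T.indicator (fun _ : Euc2 => (1:ℝ)) x + l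
    by_cases hx : x ∈ T
    · rw [indicator_of_mem hx]; nlinarith [norm_nonneg (Zl (fderiv ℝ u x))]
    · rw [indicator_of_notMem hx]
      simp only [hT, mem_ofPred_eq, not_le] at hx; linarith)
  rw [integral_sub' i1 hIu, integral_add' i3 i2, integral_indicator hTm,
    Measure.restrict_restrict hTm] at h
  simp [measureReal_def] at h
  unfold En
  linarith

theorem density {Ω : Set Euc2} (hΩo : IsOpen Ω) (hΩf : volume Ω < ⊤)
    {M : Matrix (Fin 2) (Fin 2) ℝ} {R : ℝ} (hR : 4 ≤ R) {δ : ℝ} (hδ : 0 < δ)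
    {u : Euc2 → Euc2} (hu : Adm Ω M R u) {ε : ℝ} (hε : 0 < ε) :
    ∃ v, Adm Ω M R v ∧ (∀ x, ‖v x - u x‖ < ε) ∧ (volume Ω).toReal - δ < En Ω v := by
  obtain ⟨κ, hκ, hstep⟩ := step_gain
  set V := (volume Ω).toReal with hV
  have hV0 : 0 ≤ V := ENNReal.toReal_nonneg
  let l := δ / (2 * (V + 1))
  have hl : 0 < l := by simp only [l]; positivity
  have hlV : l * V ≤ δ / 2 := by
    simp only [l]
    rw [div_mul_eq_mul_div, div_le_div_iff₀ (by positivity) (by norm_num)]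
    nlinarith
  let g := κ * l ^ 2 * (δ / 2)
  have hg : 0 < g := by simp only [g]; positivity
  have key : ∀ n : ℕ, ∀ ε : ℝ, 0 < ε → ∃ v, Adm Ω M R v ∧ (∀ x, ‖v x - u x‖ < ε) ∧
      (V - δ < En Ω v ∨ n * g ≤ En Ω v) := by
    intro n
    induction n with
    | zero =>
      intro ε hε
      exact ⟨u, hu, fun x => by simpa using hε, Or.inr (by simpa using En_nonneg Ω u)⟩
    | succ n ih =>
      intro ε hε
      obtain ⟨w, hw, hwε, hw'⟩ := ih (ε / 2) (half_pos hε)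
      by_cases hc : V - δ < En Ω w
      · exact ⟨w, hw, fun x => (hwε x).trans (by linarith), Or.inl hc⟩
      have hng : n * g ≤ En Ω w := hw'.resolve_left hc
      obtain ⟨v, hv, hvε, hv'⟩ := hstep Ω hΩo hΩf M R hR w hw l (ε / 2) hl (half_pos hε)
      refine ⟨v, hv, fun x => ?_, Or.inr ?_⟩
      · calc ‖v x - u x‖ = ‖(v x - w x) + (w x - u x)‖ := by congr 1; abel
          _ ≤ _ := norm_add_le _ _
          _ < ε / 2 + ε / 2 := add_lt_add (hvε x) (hwε x)
          _ = ε := by ring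
      · have hlev := level_lower hΩo hΩf hw.smooth hw.mem hl
        have : δ / 2 ≤ (volume {x | x ∈ Ω ∧ l ≤ 1 - ‖Zl (fderiv ℝ w x)‖ ^ 2}).toReal := by
          push Not at hc
          linarith
        have : g ≤ κ * l ^ 2 * (volume {x | x ∈ Ω ∧ l ≤ 1 - ‖Zl (fderiv ℝ w x)‖ ^ 2}).toReal := by
          simp only [g]; gcongr
        push_cast
        linarith
  obtain ⟨n, hn⟩ := exists_nat_gt (V / g)
  obtain ⟨v, hv, hvε, h | h⟩ := key n ε hε
  · exact ⟨v, hv, hvε, h⟩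
  · exfalso
    have := En_le hΩf hv.smooth hv.mem
    rw [div_lt_iff₀ hg] at hn
    linarith

theorem comp_bound (A : D2) (i j : Fin 2) : |A (ee j) i| ≤ ‖A‖ := by
  have h1 : ‖(A (ee j)) i‖ ≤ ‖A (ee j)‖ := PiLp.norm_apply_le _ _
  have h2 : ‖A (ee j)‖ ≤ ‖A‖ * ‖ee j‖ := A.le_opNorm _
  have h3 : ‖ee j‖ = 1 := by simp [ee]
  rw [h3, mul_one] at h2
  exact (Real.norm_eq_abs _ ▸ h1).trans h2

theorem comp_cont (i j : Fin 2) : Continuous fun A : D2 => A (ee j) i := by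
  fun_prop

theorem cross_int {G : Euc2 → ℝ} (hG : Continuous G) (hGc : HasCompactSupport G)
    (i j : Fin 2) {L : NNReal} {F : Euc2 → Euc2} (hF : LipschitzWith L F) :
    Integrable (fun x => fderiv ℝ F x (ee j) i * G x) volume := by
  refine (hG.integrable_of_hasCompactSupport hGc).bdd_mul (c := (L : ℝ)) ?_ ?_
  · exact ((comp_cont i j).measurable.comp (measurable_fderiv ℝ F)).aestronglyMeasurable
  · refine Filter.Eventually.of_forall fun x => ?_
    rw [Real.norm_eq_abs]
    exact (comp_bound _ _ _).trans (norm_fderiv_le_of_lipschitz ℝ hF)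

theorem cross_bound {G : Euc2 → ℝ} (hG : ContDiff ℝ 1 G) (hGc : HasCompactSupport G)
    (i j : Fin 2) : ∃ K : ℝ, 0 ≤ K ∧ ∀ (L : NNReal) (F : Euc2 → Euc2), LipschitzWith L F →
      ∀ ρ : ℝ, (∀ x, ‖F x‖ ≤ ρ) → |∫ x, fderiv ℝ F x (ee j) i * G x| ≤ ρ * K := by
  obtain ⟨D, hD⟩ := hG.lipschitzWith_of_hasCompactSupport hGc (by simp)
  have hGd : Differentiable ℝ G := hG.differentiable (by simp)
  have hcont : Continuous fun x => fderiv ℝ G x (-ee j) :=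
    (hG.continuous_fderiv (by simp)).clm_apply continuous_const
  have hcs : HasCompactSupport fun x => fderiv ℝ G x (-ee j) := hGc.fderiv_apply ℝ _
  have hig := hcont.integrable_of_hasCompactSupport (μ := volume) hcs
  refine ⟨∫ x, |fderiv ℝ G x (-ee j)|, integral_nonneg fun x => abs_nonneg _, ?_⟩
  intro L F hF ρ hρ
  have hFi : LipschitzWith L fun x => F x i := by
    refine LipschitzWith.of_dist_le_mul fun x y => ?_
    refine le_trans ?_ (hF.dist_le_mul x y)
    rw [dist_eq_norm, dist_eq_norm]
    exact PiLp.norm_apply_le (F x - F y) i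
  have h1 := hFi.integral_lineDeriv_mul_eq (μ := volume) hD hGc (ee j)
  have h2 : ∫ x, fderiv ℝ F x (ee j) i * G x = ∫ x, lineDeriv ℝ (fun x => F x i) x (ee j) * G x := by
    refine integral_congr_ae ?_
    filter_upwards [hF.ae_differentiableAt (μ := volume)] with x hx
    have hp : HasFDerivAt (fun x => F x i) ((EuclideanSpace.proj i : Euc2 →L[ℝ] ℝ).comp (fderiv ℝ F x)) x :=
      (EuclideanSpace.proj i : Euc2 →L[ℝ] ℝ).hasFDerivAt.comp x hx.hasFDerivAt
    rw [hp.differentiableAt.lineDeriv_eq_fderiv, hp.fderiv]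
    simp
  rw [h2, h1, ← integral_const_mul, ← Real.norm_eq_abs]
  refine norm_integral_le_of_norm_le (hig.abs.const_mul ρ) (Filter.Eventually.of_forall fun x => ?_)
  rw [(hGd x).lineDeriv_eq_fderiv, norm_mul, Real.norm_eq_abs, mul_comm]
  refine mul_le_mul_of_nonneg_right ?_ (abs_nonneg _)
  exact (PiLp.norm_apply_le (F x) i).trans (hρ x)

theorem Adm_lip {Ω : Set Euc2} {M : Matrix (Fin 2) (Fin 2) ℝ} {R : ℝ} {u : Euc2 → Euc2}
    (hu : Adm Ω M R u) : LipschitzWith (4 * (R + 1)).toNNReal u := by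
  refine lipschitzWith_of_nnnorm_fderiv_le (𝕜 := ℝ) (hu.smooth.differentiable (by simp)) fun x => ?_
  have := UU_norm_bound (hu.mem x) (hu.tr x)
  rw [← NNReal.coe_le_coe]
  exact this.trans (Real.le_coe_toNNReal _)

theorem Zl_bound : ∃ K : ℝ, ∀ A, ‖Zl A‖ ≤ K * ‖A‖ :=
  ⟨‖LinearMap.toContinuousLinearMap Zl‖, fun A => (LinearMap.toContinuousLinearMap Zl).le_opNorm A⟩

theorem intEn_lip {Ω : Set Euc2} (hΩf : volume Ω < ⊤) {L : NNReal} {w : Euc2 → Euc2}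
    (hw : LipschitzWith L w) : IntegrableOn (fun x => ‖Zl (fderiv ℝ w x)‖ ^ 2) Ω volume := by
  have : IsFiniteMeasure (volume.restrict Ω) := ⟨by simpa using hΩf⟩
  obtain ⟨K, hK⟩ := Zl_bound
  refine Integrable.of_bound (C := (|K| * L) ^ 2)
    ((((Zl_cont.norm.pow 2).measurable).comp (measurable_fderiv ℝ w)).aestronglyMeasurable)
    (Filter.Eventually.of_forall fun x => ?_)
  rw [Real.norm_eq_abs, abs_of_nonneg (by positivity)]
  refine pow_le_pow_left₀ (norm_nonneg _) ((hK _).trans ?_) 2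
  exact mul_le_mul (le_abs_self K) (norm_fderiv_le_of_lipschitz ℝ hw) (norm_nonneg _) (abs_nonneg _)

theorem lsc {Ω : Set Euc2} (hΩo : IsOpen Ω) (hΩf : volume Ω < ⊤)
    {M : Matrix (Fin 2) (Fin 2) ℝ} {R : ℝ} {u : Euc2 → Euc2} (hu : Adm Ω M R u) {δ : ℝ} (hδ : 0 < δ) :
    ∃ ρ : ℝ, 0 < ρ ∧ ∀ (L : NNReal) (w : Euc2 → Euc2), LipschitzWith L w → (∀ x, ‖w x - u x‖ ≤ ρ) →
      En Ω u - δ ≤ En Ω w := by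
  have hfin : IsFiniteMeasure (volume.restrict Ω) := ⟨by simpa using hΩf⟩
  obtain ⟨C, hCΩ, hC, hCv⟩ := hΩo.measurableSet.exists_isCompact_sdiff_lt hΩf.ne
    (ε := ENNReal.ofReal (δ / 2)) (by simpa using hδ)
  obtain ⟨C', hC', hCC', hC'Ω⟩ := exists_compact_between hC hΩo hCΩ
  obtain ⟨χ, hχ, hχr, hχs, hχ1⟩ := exists_contMDiff_support_eq_eq_one_iff (n := ⊤)
    (modelWithCornersSelf ℝ Euc2) (isOpen_interior (s := C')) hC.isClosed hCC'
  have hχd : ContDiff ℝ ∞ χ := hχ.contDiff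
  have hχ01 : ∀ x, 0 ≤ χ x ∧ χ x ≤ 1 := fun x => hχr (mem_range_self x)
  have hχ0 : ∀ x, x ∉ C' → χ x = 0 := fun x hx => by
    by_contra h
    have : x ∈ Function.support χ := h
    rw [hχs] at this
    exact hx (interior_subset this)
  have hχc : HasCompactSupport χ := HasCompactSupport.intro hC' hχ0
  have hDu : ContDiff ℝ 1 (fderiv ℝ u) := hu.smooth.fderiv_right (by norm_cast)
  have hZ : ContDiff ℝ 1 fun x => Zl (fderiv ℝ u x) :=
    (LinearMap.toContinuousLinearMap Zl).contDiff.comp hDu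
  let a : Euc2 → ℝ := fun x => χ x * (Zl (fderiv ℝ u x)).re
  let b : Euc2 → ℝ := fun x => χ x * (Zl (fderiv ℝ u x)).im
  have ha : ContDiff ℝ 1 a := (hχd.of_le (by norm_cast)).mul (Complex.reCLM.contDiff.comp hZ)
  have hb : ContDiff ℝ 1 b := (hχd.of_le (by norm_cast)).mul (Complex.imCLM.contDiff.comp hZ)
  have hac : HasCompactSupport a := hχc.mul_right
  have hbc : HasCompactSupport b := hχc.mul_right
  obtain ⟨K1, hK1, B1⟩ := cross_bound ha hac 0 0
  obtain ⟨K2, hK2, B2⟩ := cross_bound ha hac 1 1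
  obtain ⟨K3, hK3, B3⟩ := cross_bound hb hbc 0 1
  obtain ⟨K4, hK4, B4⟩ := cross_bound hb hbc 1 0
  have hKp : 0 < K1 + K2 + K3 + K4 + 1 := by positivity
  refine ⟨δ / 2 / (K1 + K2 + K3 + K4 + 1), by positivity, ?_⟩
  intro L w hw hwu
  set ρ := δ / 2 / (K1 + K2 + K3 + K4 + 1) with hρ
  have hρ0 : 0 < ρ := by positivity
  have hρK : ρ * (K1 + K2 + K3 + K4) ≤ δ / 2 := by
    have : ρ * (K1 + K2 + K3 + K4 + 1) = δ / 2 := by rw [hρ]; field_simp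
    nlinarith
  have hF := hw.sub (Adm_lip hu)
  set F : Euc2 → Euc2 := fun x => w x - u x with hFd
  have c1 := B1 _ F hF ρ hwu
  have c2 := B2 _ F hF ρ hwu
  have c3 := B3 _ F hF ρ hwu
  have c4 := B4 _ F hF ρ hwu
  have i1 := cross_int ha.continuous hac 0 0 hF
  have i2 := cross_int ha.continuous hac 1 1 hF
  have i3 := cross_int hb.continuous hbc 0 1 hF
  have i4 := cross_int hb.continuous hbc 1 0 hF
  let T : Euc2 → ℝ := fun x => fderiv ℝ F x (ee 0) 0 * a x - fderiv ℝ F x (ee 1) 1 * a x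
    + fderiv ℝ F x (ee 1) 0 * b x + fderiv ℝ F x (ee 0) 1 * b x
  have hTi : Integrable T volume := ((i1.sub i2).add i3).add i4
  have hTb : -(δ / 2) ≤ ∫ x, T x := by
    have : ∫ x, T x = (∫ x, fderiv ℝ F x (ee 0) 0 * a x) - (∫ x, fderiv ℝ F x (ee 1) 1 * a x)
        + (∫ x, fderiv ℝ F x (ee 1) 0 * b x) + (∫ x, fderiv ℝ F x (ee 0) 1 * b x) := by
      have s1 := integral_sub i1 i2
      have s2 := integral_add (i1.sub i2) i3
      have s3 := integral_add ((i1.sub i2).add i3) i4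
      simp only [Pi.sub_apply, Pi.add_apply] at s1 s2 s3
      simp only [T]
      rw [s3, s2, s1]
    rw [this]
    have := abs_le.1 c1
    have := abs_le.1 c2
    have := abs_le.1 c3
    have := abs_le.1 c4
    linarith [hρK, mul_add ρ (K1 + K2 + K3) K4, mul_add ρ (K1 + K2) K3, mul_add ρ K1 K2]
  have hTΩ : ∫ x in Ω, T x = ∫ x, T x := by
    refine setIntegral_eq_integral_of_forall_compl_eq_zero fun x hx => ?_
    have : χ x = 0 := hχ0 x fun h => hx (hC'Ω h)
    simp [T, a, b, this]
  -- indicator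
  have hind : ∫ x in Ω, Cᶜ.indicator (fun _ => (1:ℝ)) x ≤ δ / 2 := by
    rw [integral_indicator hC.isClosed.measurableSet.compl, Measure.restrict_restrict
      hC.isClosed.measurableSet.compl]
    simp only [integral_const, smul_eq_mul, mul_one, measureReal_def, Measure.restrict_apply_univ]
    have : Cᶜ ∩ Ω = Ω \ C := by ext x; simp [and_comm]
    rw [this]
    exact ENNReal.toReal_le_of_le_ofReal (by positivity) hCv.le
  have hindi : IntegrableOn (Cᶜ.indicator (fun _ => (1:ℝ))) Ω volume :=
    (integrable_const (1:ℝ)).indicator hC.isClosed.measurableSet.compl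
  have hmain : ∫ x in Ω, (‖Zl (fderiv ℝ u x)‖ ^ 2 - Cᶜ.indicator (fun _ => (1:ℝ)) x + T x) ≤ En Ω w := by
    refine integral_mono_ae (((intEn hΩf hu.smooth hu.mem).sub hindi).add hTi.integrableOn)
      (intEn_lip hΩf hw) ?_
    filter_upwards [ae_restrict_of_ae (hw.ae_differentiableAt (μ := volume))] with x hx
    have hFx : fderiv ℝ w x = fderiv ℝ u x + fderiv ℝ F x := by
      have : fderiv ℝ F x = fderiv ℝ w x - fderiv ℝ u x :=
        fderiv_fun_sub hx (hu.smooth.differentiable (by simp) x)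
      rw [this]; abel
    have hTx : T x = χ x * (2 * cin (Zl (fderiv ℝ u x)) (Zl (fderiv ℝ F x))) := by
      simp only [T, a, b, cin]
      simp only [Zl, LinearMap.coe_mk, AddHom.coe_mk]
      ring
    have hn := norm_add_sq_cin (Zl (fderiv ℝ u x)) (Zl (fderiv ℝ F x))
    rw [← map_add, ← hFx] at hn
    have h1 : ‖Zl (fderiv ℝ u x)‖ ^ 2 - Cᶜ.indicator (fun _ => (1:ℝ)) x ≤ χ x * ‖Zl (fderiv ℝ u x)‖ ^ 2 := by
      have hz := UU_Z_le (hu.mem x)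
      have hz2 : ‖Zl (fderiv ℝ u x)‖ ^ 2 ≤ 1 := by nlinarith [norm_nonneg (Zl (fderiv ℝ u x))]
      by_cases hxC : x ∈ C
      · have := (hχ1 x).1 hxC
        simp [hxC, this]
      · simp only [indicator, mem_compl_iff, hxC, not_false_iff, if_true]
        nlinarith [mul_nonneg (hχ01 x).1 (sq_nonneg ‖Zl (fderiv ℝ u x)‖)]
    show _ - _ + T x ≤ _
    rw [hTx]
    have hp := sq_nonneg ‖Zl (fderiv ℝ F x)‖
    have hq := sq_nonneg ‖Zl (fderiv ℝ w x)‖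
    have h3 : χ x * ‖Zl (fderiv ℝ w x)‖ ^ 2 ≤ ‖Zl (fderiv ℝ w x)‖ ^ 2 := by
      nlinarith [hχ01 x]
    have h4 : 0 ≤ χ x * ‖Zl (fderiv ℝ F x)‖ ^ 2 := mul_nonneg (hχ01 x).1 hp
    have h5 : ‖Zl (fderiv ℝ w x)‖ ^ 2 = ‖Zl (fderiv ℝ u x)‖ ^ 2 + ‖Zl (fderiv ℝ F x)‖ ^ 2 +
      2 * cin (Zl (fderiv ℝ u x)) (Zl (fderiv ℝ F x)) := by linarith
    have h6 : χ x * ‖Zl (fderiv ℝ w x)‖ ^ 2 = χ x * ‖Zl (fderiv ℝ u x)‖ ^ 2 + χ x * ‖Zl (fderiv ℝ F x)‖ ^ 2 +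
      χ x * (2 * cin (Zl (fderiv ℝ u x)) (Zl (fderiv ℝ F x))) := by rw [h5]; ring
    linarith
  have e1 : ∫ x in Ω, (‖Zl (fderiv ℝ u x)‖ ^ 2 - Cᶜ.indicator (fun _ => (1:ℝ)) x + T x) =
      En Ω u - (∫ x in Ω, Cᶜ.indicator (fun _ => (1:ℝ)) x) + ∫ x in Ω, T x := by
    have s1 := integral_sub (intEn hΩf hu.smooth hu.mem) hindi
    have s2 := integral_add ((intEn hΩf hu.smooth hu.mem).sub hindi) hTi.integrableOn
    simp only [Pi.sub_apply] at s1 s2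
    rw [s2, s1, En]
  rw [e1, hTΩ] at hmain
  linarith

def na : Fin 3 → ℝ := ![1, 1/2, 1/2]
def nb : Fin 3 → ℝ := ![0, Real.sqrt 3 / 2, -Real.sqrt 3 / 2]
def nn (i : Fin 3) : Euc2 := na i • ee 0 + nb i • ee 1
def nj (i : Fin 3) : Euc2 := (-nb i) • ee 0 + na i • ee 1

theorem na_nb (i : Fin 3) : na i ^ 2 + nb i ^ 2 = 1 ∧ na i ^ 2 - nb i ^ 2 = (nu i).re ∧
    2 * (na i * nb i) = (nu i).im := by
  have := sq3
  fin_cases i <;> simp [na, nb, nu] <;> (try constructor) <;> nlinarith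

theorem quad_nn (A : D2) (i : Fin 3) :
    innerSL ℝ (nn i) (A (nn i)) = trl A / 2 + pr i (Zl A) := by
  obtain ⟨h1, h2, h3⟩ := na_nb i
  have e : innerSL ℝ (nn i) (A (nn i)) = na i ^ 2 * A (ee 0) 0 + na i * nb i * (A (ee 1) 0 + A (ee 0) 1)
      + nb i ^ 2 * A (ee 1) 1 := by
    simp only [nn, map_add, map_smul, innerSL_apply_apply, inner_add_left, inner_add_right, inner_smul_left,
      inner_smul_right, ContinuousLinearMap.add_apply, ContinuousLinearMap.smul_apply, real_inner_comm _ (ee _), inner_ee]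
    simp [inner_ee, real_inner_comm]
    ring
  rw [e, pr, ← h2, ← h3]
  simp only [trl, Zl, LinearMap.coe_mk, AddHom.coe_mk]
  linear_combination ((A (ee 0) 0 + A (ee 1) 1) / 2) * h1

theorem quad_nj (A : D2) (i : Fin 3) :
    innerSL ℝ (nj i) (A (nj i)) = trl A / 2 - pr i (Zl A) := by
  obtain ⟨h1, h2, h3⟩ := na_nb i
  have e : innerSL ℝ (nj i) (A (nj i)) = nb i ^ 2 * A (ee 0) 0 - na i * nb i * (A (ee 1) 0 + A (ee 0) 1)
      + na i ^ 2 * A (ee 1) 1 := by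
    simp only [nj, map_add, map_smul, innerSL_apply_apply, inner_add_left, inner_add_right, inner_smul_left,
      inner_smul_right, ContinuousLinearMap.add_apply, ContinuousLinearMap.smul_apply, real_inner_comm _ (ee _), inner_ee]
    simp [inner_ee, real_inner_comm]
    ring
  rw [e, pr, ← h2, ← h3]
  simp only [trl, Zl, LinearMap.coe_mk, AddHom.coe_mk]
  linear_combination ((A (ee 0) 0 + A (ee 1) 1) / 2) * h1

theorem lim_deriv {U : ℕ → Euc2 → Euc2} {u : Euc2 → Euc2} (hU : ∀ j, Differentiable ℝ (U j))
    (hlim : ∀ x, Filter.Tendsto (fun j => U j x) Filter.atTop (nhds (u x)))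
    (l : Euc2 →L[ℝ] ℝ) (n : Euc2) {c : ℝ} (hc : ∀ j x, c ≤ l (fderiv ℝ (U j) x n)) {x : Euc2}
    (hx : DifferentiableAt ℝ u x) : c ≤ l (fderiv ℝ u x n) := by
  have hline : ∀ (t : ℝ), HasDerivAt (fun t : ℝ => x + t • n) n t := fun t => by
    simpa using ((hasDerivAt_id t).smul_const n).const_add x
  have h1 : ∀ j, ∀ t : ℝ, 0 ≤ t → c * t ≤ l (U j (x + t • n)) - l (U j x) := by
    intro j t ht
    have hd : ∀ s : ℝ, HasDerivAt (fun s : ℝ => l (U j (x + s • n))) (l (fderiv ℝ (U j) (x + s • n) n)) s := by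
      intro s
      exact l.hasFDerivAt.comp_hasDerivAt s ((hU j _).hasFDerivAt.comp_hasDerivAt s (hline s))
    have := mul_sub_le_image_sub_of_le_deriv (f := fun s : ℝ => l (U j (x + s • n)))
      (fun s => (hd s).differentiableAt) (C := c) (fun s => by rw [(hd s).deriv]; exact hc _ _) ht
    simpa using this
  have h2 : ∀ t : ℝ, 0 ≤ t → c * t ≤ l (u (x + t • n)) - l (u x) := by
    intro t ht
    refine ge_of_tendsto' (((l.continuous.tendsto _).comp (hlim (x + t • n))).sub
      ((l.continuous.tendsto _).comp (hlim x))) fun j => h1 j t ht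
  have hx' : HasFDerivAt u (fderiv ℝ u x) (x + (0:ℝ) • n) := by simpa using hx.hasFDerivAt
  have hd : HasDerivAt (fun s : ℝ => l (u (x + s • n))) (l (fderiv ℝ u x n)) 0 :=
    l.hasFDerivAt.comp_hasDerivAt 0 (hx'.comp_hasDerivAt (0:ℝ) (hline 0))
  have ht := hd.tendsto_slope_zero_right
  refine ge_of_tendsto ht ?_
  filter_upwards [self_mem_nhdsWithin] with t ht
  have ht' : 0 < t := ht
  have := h2 t ht'.le
  simp only [zero_add, zero_smul, add_zero, smul_eq_mul]
  rw [← div_eq_inv_mul, le_div_iff₀ ht']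
  exact this

theorem lim_constraint {Ω : Set Euc2} {M : Matrix (Fin 2) (Fin 2) ℝ} {R : ℝ}
    {U : ℕ → Euc2 → Euc2} {u : Euc2 → Euc2} (hU : ∀ j, Adm Ω M R (U j))
    (hlim : ∀ x, Filter.Tendsto (fun j => U j x) Filter.atTop (nhds (u x))) {x : Euc2}
    (hx : DifferentiableAt ℝ u x) (i : Fin 3) :
    -1/2 ≤ pr i (Zl (fderiv ℝ u x)) ∧ (pr i (Zl (fderiv ℝ u x)) = 1 → trl (fderiv ℝ u x) = 0) := by
  have hd : ∀ j, Differentiable ℝ (U j) := fun j => (hU j).smooth.differentiable (by simp)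
  have hpr : ∀ j x, -1/2 ≤ pr i (Zl (fderiv ℝ (U j) x)) ∧ pr i (Zl (fderiv ℝ (U j) x)) ≤ 1 := by
    intro j x
    have h := ((hU j).mem x).1
    have hs := pr_sum (Zl (fderiv ℝ (U j) x))
    refine ⟨(h i).le, ?_⟩
    have h0 := h 0
    have h1 := h 1
    have h2 := h 2
    fin_cases i
    · show pr 0 _ ≤ 1; linarith
    · show pr 1 _ ≤ 1; linarith
    · show pr 2 _ ≤ 1; linarith
  have a1 := lim_deriv hd hlim (innerSL ℝ (nn i)) (nn i) (c := -1/2) (fun j x => by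
    rw [quad_nn, (hU j).tr]; linarith [hpr j x]) hx
  have a2 := lim_deriv hd hlim (-innerSL ℝ (nn i)) (nn i) (c := -1) (fun j x => by
    rw [ContinuousLinearMap.neg_apply, quad_nn, (hU j).tr]; linarith [hpr j x]) hx
  have a3 := lim_deriv hd hlim (innerSL ℝ (nj i)) (nj i) (c := -1) (fun j x => by
    rw [quad_nj, (hU j).tr]; linarith [hpr j x]) hx
  have a4 := lim_deriv hd hlim (-innerSL ℝ (nj i)) (nj i) (c := -1/2) (fun j x => by
    rw [ContinuousLinearMap.neg_apply, quad_nj, (hU j).tr]; linarith [hpr j x]) hx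
  rw [ContinuousLinearMap.neg_apply] at a2 a4
  rw [quad_nn] at a1 a2
  rw [quad_nj] at a3 a4
  refine ⟨by linarith, fun h => by linarith⟩

def AM (M : Matrix (Fin 2) (Fin 2) ℝ) : D2 := LinearMap.toContinuousLinearMap
  { toFun := matVec2 M
    map_add' := fun x y => by
      ext i; fin_cases i <;> simp [matVec2] <;> ring
    map_smul' := fun c x => by
      ext i; fin_cases i <;> simp [matVec2] <;> ring }

theorem AM_apply (M : Matrix (Fin 2) (Fin 2) ℝ) (x : Euc2) : AM M x = matVec2 M x := rfl

theorem AM_ee (M : Matrix (Fin 2) (Fin 2) ℝ) (i j : Fin 2) : AM M (ee j) i = M i j := by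
  rw [AM_apply]
  fin_cases j <;> simp [matVec2, ee]

theorem AM_fderiv (M : Matrix (Fin 2) (Fin 2) ℝ) (x : Euc2) : fderiv ℝ (matVec2 M) x = AM M :=
  (AM M).hasFDerivAt.fderiv

theorem adm_init (Ω : Set Euc2) {M : Matrix (Fin 2) (Fin 2) ℝ} (hM : inIntConv (symPart M)) :
    ∃ R : ℝ, 4 ≤ R ∧ Adm Ω M R (matVec2 M) := by
  obtain ⟨lam, hl, hs, he⟩ := hM
  have e00 := congrFun (congrFun he 0) 0
  have e01 := congrFun (congrFun he 0) 1
  have e11 := congrFun (congrFun he 1) 1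
  rw [Fin.sum_univ_three] at hs
  simp [symPart, Fin.sum_univ_three, hexWells] at e00 e01 e11
  have l0 := hl 0
  have l1 := hl 1
  have l2 := hl 2
  have q := sq3
  have zre : (Zl (AM M)).re = lam 0 - lam 1 / 2 - lam 2 / 2 := by
    simp only [Zl, LinearMap.coe_mk, AddHom.coe_mk, AM_ee]
    linarith
  have zim : (Zl (AM M)).im = Real.sqrt 3 / 2 * (lam 1 - lam 2) := by
    simp only [Zl, LinearMap.coe_mk, AddHom.coe_mk, AM_ee]
    linarith
  refine ⟨max 4 (|skl (AM M)| + ‖Zl (AM M) - nu 0‖ + 1), le_max_left _ _, ?_, ?_, ?_, ?_⟩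
  · exact (AM M).contDiff
  · exact ⟨∅, isCompact_empty, empty_subset _, fun _ _ => rfl⟩
  · intro x
    rw [AM_fderiv]
    simp only [trl, LinearMap.coe_mk, AddHom.coe_mk, AM_ee]
    linarith
  · intro x
    rw [AM_fderiv]
    refine ⟨fun i => ?_, 0, lt_of_lt_of_le (by linarith) (le_max_right _ _)⟩
    rw [pr, zre, zim]
    fin_cases i <;> simp [nu] <;> nlinarith

theorem finish {x : Euc2} {u : Euc2 → Euc2} {i : Fin 3} (hz : Zl (fderiv ℝ u x) = nu i)
    (ht : trl (fderiv ℝ u x) = 0) : symPart (grad2 u x) = hexWells i := by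
  have hre := congrArg Complex.re hz
  have him := congrArg Complex.im hz
  simp only [Zl, trl, LinearMap.coe_mk, AddHom.coe_mk, ee] at hre him ht
  ext a b
  fin_cases i <;> simp [nu] at hre him <;> fin_cases a <;> fin_cases b <;>
    simp [symPart, grad2, hexWells] <;> linarith

/-- one step of the iteration -/
theorem iter_step {Ω : Set Euc2} (hΩo : IsOpen Ω) (hΩf : volume Ω < ⊤)
    {M : Matrix (Fin 2) (Fin 2) ℝ} {R : ℝ} (hR : 4 ≤ R) (j : ℕ)
    (p : {p : (Euc2 → Euc2) × ℝ // Adm Ω M R p.1 ∧ 0 < p.2}) :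
    ∃ q : {p : (Euc2 → Euc2) × ℝ // Adm Ω M R p.1 ∧ 0 < p.2},
      (∀ x, ‖q.1.1 x - p.1.1 x‖ ≤ p.1.2 / 2) ∧ q.1.2 ≤ p.1.2 / 2 ∧
      ∀ (L : NNReal) (w : Euc2 → Euc2), LipschitzWith L w → (∀ x, ‖w x - q.1.1 x‖ ≤ q.1.2) →
        (volume Ω).toReal - 2 * (1 / ((j : ℝ) + 1)) ≤ En Ω w := by
  obtain ⟨⟨u, ρ⟩, hu, hρ⟩ := p
  have hδ : (0:ℝ) < 1 / ((j : ℝ) + 1) := by positivity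
  have hρ' : 0 < ρ := hρ
  obtain ⟨v, hv, hvu, hvE⟩ := density hΩo hΩf hR hδ hu (half_pos hρ')
  obtain ⟨r, hr, hrl⟩ := lsc hΩo hΩf hv hδ
  refine ⟨⟨(v, min r (ρ / 2)), hv, lt_min hr (half_pos hρ')⟩, fun x => (hvu x).le, min_le_right _ _, ?_⟩
  intro L w hw hwv
  have := hrl L w hw fun x => (hwv x).trans (min_le_left _ _)
  linarith

theorem main_exists (Ω : Set Euc2) (hΩo : IsOpen Ω) (hΩf : volume Ω < ⊤)
    (M : Matrix (Fin 2) (Fin 2) ℝ) (hM : inIntConv (symPart M)) (ε : ℝ) (hε : 0 < ε) :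
    ∃ (u : Euc2 → Euc2) (L : NNReal), LipschitzWith L u ∧
      (∀ᵐ x ∂(volume : Measure Euc2), x ∈ Ω → symPart (grad2 u x) ∈ hexK) ∧
      (∀ x ∈ frontier Ω, u x = matVec2 M x) ∧
      (∀ x ∈ Ω, ‖u x - matVec2 M x‖ < ε) := by
  obtain ⟨R, hR, h0⟩ := adm_init Ω hM
  choose next hn1 hn2 hn3 using fun (j : ℕ) p => iter_step (M := M) hΩo hΩf hR j p
  let P : ℕ → {p : (Euc2 → Euc2) × ℝ // Adm Ω M R p.1 ∧ 0 < p.2} := fun j =>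
    Nat.rec ⟨(matVec2 M, ε / 2), h0, half_pos hε⟩ (fun k p => next k p) j
  have hPs : ∀ j, P (j + 1) = next j (P j) := fun j => rfl
  let U : ℕ → Euc2 → Euc2 := fun j => (P j).1.1
  let ρ : ℕ → ℝ := fun j => (P j).1.2
  have hU : ∀ j, Adm Ω M R (U j) := fun j => (P j).2.1
  have hρ0 : ∀ j, 0 < ρ j := fun j => (P j).2.2
  have hU1 : ∀ j x, ‖U (j + 1) x - U j x‖ ≤ ρ j / 2 := fun j x => by
    simp only [U, ρ, hPs]; exact hn1 j (P j) x
  have hρ1 : ∀ j, ρ (j + 1) ≤ ρ j / 2 := fun j => by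
    simp only [ρ, hPs]; exact hn2 j (P j)
  have hE : ∀ j (L : NNReal) (w : Euc2 → Euc2), LipschitzWith L w →
      (∀ x, ‖w x - U (j + 1) x‖ ≤ ρ (j + 1)) →
        (volume Ω).toReal - 2 * (1 / ((j : ℝ) + 1)) ≤ En Ω w := fun j => by
    simp only [U, ρ, hPs]; exact hn3 j (P j)
  have hclose : ∀ j k x, ‖U (j + k) x - U j x‖ + ρ (j + k) ≤ ρ j := by
    intro j k x
    induction k with
    | zero => simp
    | succ k ih =>
      have h1 := hU1 (j + k) x
      have h2 := hρ1 (j + k)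
      have h3 := norm_sub_le_norm_sub_add_norm_sub (U (j + k + 1) x) (U (j + k) x) (U j x)
      rw [← add_assoc]
      linarith
  have hgeo : ∀ j, ρ j ≤ ρ 0 / 2 ^ j := by
    intro j
    induction j with
    | zero => simp
    | succ k ih =>
      have h := hρ1 k
      have : ρ 0 / 2 ^ (k + 1) = ρ 0 / 2 ^ k / 2 := by rw [pow_succ]; field_simp
      linarith
  have hcau : ∀ x, CauchySeq fun j => U j x := by
    intro x
    refine cauchySeq_of_le_geometric_two (C := ρ 0) fun j => ?_
    rw [dist_comm, dist_eq_norm]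
    refine (hU1 j x).trans ?_
    have := hgeo j
    calc ρ j / 2 ≤ ρ 0 / 2 ^ j / 2 := by linarith
      _ = ρ 0 / 2 / 2 ^ j := by ring
  choose u hu using fun x => cauchySeq_tendsto_of_complete (hcau x)
  have huU : ∀ j x, ‖u x - U j x‖ ≤ ρ j := by
    intro j x
    refine le_of_tendsto ((hu x).sub_const (U j x)).norm ?_
    filter_upwards [Filter.eventually_ge_atTop j] with m hm
    obtain ⟨k, rfl⟩ := Nat.exists_eq_add_of_le hm
    have h1 := hclose j k x
    have h2 := hρ0 (j + k)
    linarith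
  have hlip : LipschitzWith (4 * (R + 1)).toNNReal u := by
    refine LipschitzWith.of_dist_le_mul fun x y => ?_
    exact le_of_tendsto' ((hu x).dist (hu y)) fun j => (Adm_lip (hU j)).dist_le_mul x y
  refine ⟨u, _, hlip, ?_, ?_, ?_⟩
  · have hEn : (volume Ω).toReal ≤ En Ω u := by
      by_contra! hcon
      obtain ⟨j, hj⟩ := exists_nat_one_div_lt (K := ℝ)
        (show (0:ℝ) < ((volume Ω).toReal - En Ω u) / 2 by linarith)
      have := hE j _ u hlip (huU (j + 1))
      linarith
    have hd := hlip.ae_differentiableAt (μ := volume)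
    have hfin : IsFiniteMeasure (volume.restrict Ω) := ⟨by simpa using hΩf⟩
    have hi : Integrable (fun x => 1 - ‖Zl (fderiv ℝ u x)‖ ^ 2) (volume.restrict Ω) :=
      (integrable_const (1:ℝ)).sub (intEn_lip hΩf hlip)
    have hnn : 0 ≤ᵐ[volume.restrict Ω] fun x => 1 - ‖Zl (fderiv ℝ u x)‖ ^ 2 := by
      filter_upwards [ae_restrict_of_ae hd] with x hx
      have := norm_le_one_of_tri fun i => (lim_constraint hU hu hx i).1
      show (0:ℝ) ≤ 1 - ‖Zl (fderiv ℝ u x)‖ ^ 2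
      nlinarith [norm_nonneg (Zl (fderiv ℝ u x))]
    have hig : ∫ x in Ω, (1 - ‖Zl (fderiv ℝ u x)‖ ^ 2) = (volume Ω).toReal - En Ω u := by
      rw [integral_sub (integrable_const (1:ℝ)) (intEn_lip hΩf hlip), En]
      simp [measureReal_def]
    have hzero : ∫ x in Ω, (1 - ‖Zl (fderiv ℝ u x)‖ ^ 2) = 0 :=
      le_antisymm (by rw [hig]; linarith) (integral_nonneg_of_ae hnn)
    have hae := (integral_eq_zero_iff_of_nonneg_ae hnn hi).1 hzero
    have hae' := (ae_restrict_iff' hΩo.measurableSet).1 hae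
    filter_upwards [hae', hd] with x hx hxd hxΩ
    have h1 : 1 - ‖Zl (fderiv ℝ u x)‖ ^ 2 = 0 := hx hxΩ
    obtain ⟨i, hi⟩ := vertex_of_norm (fun i => (lim_constraint hU hu hxd i).1)
      (by linarith : 1 ≤ ‖Zl (fderiv ℝ u x)‖ ^ 2)
    have ht := (lim_constraint hU hu hxd i).2 (by rw [hi, pr_nu]; simp)
    rw [finish hi ht, hexK]
    fin_cases i <;> simp
  · intro x hx
    have hxΩ : x ∉ Ω := fun h => by
      rw [hΩo.frontier_eq] at hx
      exact hx.2 h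
    have : ∀ j, U j x = matVec2 M x := fun j => by
      obtain ⟨C, _, hC, h⟩ := (hU j).bdry
      exact h x fun h => hxΩ (hC h)
    have hl := hu x
    simp only [this] at hl
    exact tendsto_nhds_unique hl tendsto_const_nhds |>.trans rfl
  · intro x _
    have := huU 0 x
    have e : ρ 0 = ε / 2 := rfl
    have e' : U 0 x = matVec2 M x := rfl
    rw [e, e'] at this
    linarith

/-- Existence of convex integration solutions: for any `M` whose
symmetric part lies in the interior of the convex hull of the wells, the differential
inclusion `e(∇u) ∈ {e⁽¹⁾, e⁽²⁾, e⁽³⁾}` a.e. in `Ω`, `u = Mx` on `∂Ω`, admits a Lipschitz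
solution, and for every `ε > 0` it admits one which is `ε`-close to `Mx` in `L^∞(Ω)`. -/
theorem statement6 (Ω : Set Euc2) (hΩo : IsOpen Ω) (hΩb : Bornology.IsBounded Ω)
    (hΩL : IsLipschitzDomain Ω)
    (M : Matrix (Fin 2) (Fin 2) ℝ) (hM : inIntConv (symPart M)) :
    (∃ (u : Euc2 → Euc2) (L : NNReal), LipschitzWith L u ∧
      (∀ᵐ x ∂(volume : Measure Euc2), x ∈ Ω → symPart (grad2 u x) ∈ hexK) ∧
      (∀ x ∈ frontier Ω, u x = matVec2 M x)) ∧
    (∀ ε : ℝ, 0 < ε → ∃ (u : Euc2 → Euc2) (L : NNReal), LipschitzWith L u ∧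
      (∀ᵐ x ∂(volume : Measure Euc2), x ∈ Ω → symPart (grad2 u x) ∈ hexK) ∧
      (∀ x ∈ frontier Ω, u x = matVec2 M x) ∧
      (∀ x ∈ Ω, ‖u x - matVec2 M x‖ < ε)) := by
  have H := main_exists Ω hΩo hΩb.measure_lt_top M hM
  refine ⟨?_, H⟩
  obtain ⟨u, L, h1, h2, h3, _⟩ := H 1 one_pos
  exact ⟨u, L, h1, h2, h3⟩
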